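/- (Claim 4) Let A₁, A₂ be as in Claims 2–3 and let A₃'={x^{2_{[p]}}, t^{2_{[q]}} : p∈I_{1,5}, q∈I₆}, with A₃=A₃'∪{x^{2_{[0]}}} if Γ₀≠{0} and A₃=A₃'∪{t₀} if Γ₀={0}. If a derivation d of 𝒦 vanishes on A₁∪A₂, then there exists u∈𝒦 such that d−ad u vanishes on A₁∪A₂∪A₃. -/

import Mathlib

noncomputable section

/-- `ι_i = ℓ₁ + ⋯ + ℓ_i`. -/
def iot (ℓ : ℕ → ℕ) (i : ℕ) : ℕ := ∑ k ∈ Finset.Icc 1 i, ℓ k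

/-- `I_{i,j} = {ι_{i-1}+1, …, ι_j}`. -/
def iSet (ℓ : ℕ → ℕ) (i j : ℕ) : Finset ℕ := Finset.Icc (iot ℓ (i - 1) + 1) (iot ℓ j)

/-- The index-shift map `p ↦ p̄` (shift by `ι₆`). -/
def bar (ℓ : ℕ → ℕ) (p : ℕ) : ℕ := if p ≤ iot ℓ 6 then p + iot ℓ 6 else p - iot ℓ 6

/-- `K̄ = {p̄ : p ∈ K}`. -/
def barSet (ℓ : ℕ → ℕ) (K : Finset ℕ) : Finset ℕ := K.image (bar ℓ)

/-- `J_{i,j} = I_{i,j} ∪ Ī_{i,j}`. -/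
def jSet (ℓ : ℕ → ℕ) (i j : ℕ) : Finset ℕ := iSet ℓ i j ∪ barSet ℓ (iSet ℓ i j)

/-- The semigroup `𝒥 = 𝒥₀ × 𝒥₁`, encoded as functions `ℕ → ℕ`; `j0 = true`
means `𝒥₀ = ℕ` and `j0 = false` means `𝒥₀ = {0}`. -/
def jIdx (ℓ : ℕ → ℕ) (j0 : Bool) : Set (ℕ → ℕ) :=
  {i | (j0 = false → i 0 = 0) ∧
    ∀ p, 1 ≤ p →
      (p ∈ iSet ℓ 1 2 ∪ iSet ℓ 4 4 ∪ barSet ℓ (iSet ℓ 1 1) ∨ 2 * iot ℓ 6 < p) → i p = 0}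

/-- `σ_p` (with `σ_p = σ_{p̄}`). -/
def sgm (F : Type*) [Field F] (ℓ : ℕ → ℕ) (p : ℕ) : ℕ → F :=
  let q := if p ≤ iot ℓ 6 then p else p - iot ℓ 6
  if q ∈ iSet ℓ 1 3 then -Pi.single q (1 : F) - Pi.single (q + iot ℓ 6) (1 : F)
  else if q ∈ iSet ℓ 4 5 then -Pi.single q (1 : F)
  else 0

/-- The underlying space `𝒜`: the free `F`-module with basis `Γ × 𝒥`. -/
abbrev CA (F : Type*) [Field F] (ℓ : ℕ → ℕ) (Γ : AddSubgroup (ℕ → F)) (j0 : Bool) : Type _ :=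
  (↥Γ × ↥(jIdx ℓ j0)) →₀ F

/-- The basis monomial `x^{α,i⃗}`, with the convention that it is `0` if `(α,i⃗) ∉ Γ × 𝒥`. -/
def X (F : Type*) [Field F] (ℓ : ℕ → ℕ) (Γ : AddSubgroup (ℕ → F)) (j0 : Bool)
    (α : ℕ → F) (i : ℕ → ℕ) : CA F ℓ Γ j0 :=
  @dite _ (α ∈ Γ ∧ i ∈ jIdx ℓ j0) (Classical.dec _)
    (fun h => Finsupp.single (⟨α, h.1⟩, ⟨i, h.2⟩) 1) (fun _ => 0)

variable (F : Type*) [Field F] (ℓ : ℕ → ℕ) (Γ : AddSubgroup (ℕ → F)) (j0 : Bool)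

/-- The commutative associative product on `𝒜`. -/
def mulA (u v : CA F ℓ Γ j0) : CA F ℓ Γ j0 :=
  u.sum fun a ca => v.sum fun b cb =>
    (ca * cb) • X F ℓ Γ j0 (a.1.1 + b.1.1) (a.2.1 + b.2.1)

/-- The grading operator `∂*_p`. -/
def pstar (p : ℕ) (u : CA F ℓ Γ j0) : CA F ℓ Γ j0 :=
  u.sum fun a ca => (ca * a.1.1 p) • Finsupp.single a 1

/-- The down-grading operator `∂_{t_p}`. -/
def pt (p : ℕ) (u : CA F ℓ Γ j0) : CA F ℓ Γ j0 :=
  u.sum fun a ca => (ca * (a.2.1 p : F)) • X F ℓ Γ j0 a.1.1 (a.2.1 - Pi.single p 1)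

/-- `∂_p = ∂*_p + ∂_{t_p}`. -/
def dd (p : ℕ) (u : CA F ℓ Γ j0) : CA F ℓ Γ j0 := pstar F ℓ Γ j0 p u + pt F ℓ Γ j0 p u

/-- `∂ = Σ_{p∈J_{1,3}∪I_{4,5}} ∂*_p + Σ_{p∈I₆∪Ī_{4,6}} t_p ∂_{t_p}`. -/
def Dop (u : CA F ℓ Γ j0) : CA F ℓ Γ j0 :=
  (∑ p ∈ jSet ℓ 1 3 ∪ iSet ℓ 4 5, pstar F ℓ Γ j0 p u) +
    ∑ p ∈ iSet ℓ 6 6 ∪ barSet ℓ (iSet ℓ 4 6),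
      mulA F ℓ Γ j0 (X F ℓ Γ j0 0 (Pi.single p 1)) (pt F ℓ Γ j0 p u)

/-- The contact bracket (2.18):
`[u,v] = Σ_{p∈I} x^{σ_p}(∂_p u·∂_{p̄} v − ∂_{p̄} u·∂_p v) + (2−∂)(u)·∂₀(v) − ∂₀(u)·(2−∂)(v)`. -/
def brk (u v : CA F ℓ Γ j0) : CA F ℓ Γ j0 :=
  (∑ p ∈ iSet ℓ 1 6,
      mulA F ℓ Γ j0 (X F ℓ Γ j0 (sgm F ℓ p) 0)
        (mulA F ℓ Γ j0 (dd F ℓ Γ j0 p u) (dd F ℓ Γ j0 (bar ℓ p) v) -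
          mulA F ℓ Γ j0 (dd F ℓ Γ j0 (bar ℓ p) u) (dd F ℓ Γ j0 p v))) +
    mulA F ℓ Γ j0 ((2 : F) • u - Dop F ℓ Γ j0 u) (dd F ℓ Γ j0 0 v) -
    mulA F ℓ Γ j0 (dd F ℓ Γ j0 0 u) ((2 : F) • v - Dop F ℓ Γ j0 v)


/-- The set `A₁`: the ad-locally-finite but not ad-semisimple basis elements
(`x^{−σ_p}` for `p ∈ I_{2,3}`, `x^{−σ_q,1_{[q̄]}}` for `q ∈ I₅`, plus `1` if `𝒥₀ = ℕ`). -/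
def A1 (F : Type*) [Field F] (ℓ : ℕ → ℕ) (Γ : AddSubgroup (ℕ → F)) (j0 : Bool) :
    Set (CA F ℓ Γ j0) :=
  ((fun p => X F ℓ Γ j0 (-sgm F ℓ p) 0) '' ↑(iSet ℓ 2 3)) ∪
    ((fun q => X F ℓ Γ j0 (-sgm F ℓ q) (Pi.single (bar ℓ q) 1)) '' ↑(iSet ℓ 5 5)) ∪
    {y | j0 = true ∧ y = X F ℓ Γ j0 0 0}

/-- The set `A₂`: the ad-semisimple elements
(`x^{−σ_p}` for `p ∈ I₁`, `x^{−σ_q,1_{[q̄]}}` for `q ∈ I₄`, `t^{1_{[r]}+1_{[r̄]}}` for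
`r ∈ I₆`, plus `1` if `𝒥₀ = {0}`). -/
def A2 (F : Type*) [Field F] (ℓ : ℕ → ℕ) (Γ : AddSubgroup (ℕ → F)) (j0 : Bool) :
    Set (CA F ℓ Γ j0) :=
  ((fun p => X F ℓ Γ j0 (-sgm F ℓ p) 0) '' ↑(iSet ℓ 1 1)) ∪
    ((fun q => X F ℓ Γ j0 (-sgm F ℓ q) (Pi.single (bar ℓ q) 1)) '' ↑(iSet ℓ 4 4)) ∪
    ((fun r => X F ℓ Γ j0 0 (Pi.single r 1 + Pi.single (bar ℓ r) 1)) '' ↑(iSet ℓ 6 6)) ∪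
    {y | j0 = false ∧ y = X F ℓ Γ j0 0 0}

/-- The set `A₃`: `x^{2_{[p]}}` for `p ∈ I_{1,5}`, `t^{2_{[q]}}` for `q ∈ I₆`, plus
`x^{2_{[0]}}` if `Γ₀ ≠ {0}` or `t₀` if `Γ₀ = {0}`. -/
def A3 (F : Type*) [Field F] (ℓ : ℕ → ℕ) (Γ : AddSubgroup (ℕ → F)) (j0 : Bool) :
    Set (CA F ℓ Γ j0) :=
  ((fun p => X F ℓ Γ j0 (Pi.single p (2 : F)) 0) '' ↑(iSet ℓ 1 5)) ∪
    ((fun q => X F ℓ Γ j0 0 (Pi.single q 2)) '' ↑(iSet ℓ 6 6)) ∪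
    {y | ((∃ α ∈ Γ, α 0 ≠ 0) ∧ y = X F ℓ Γ j0 (Pi.single 0 (2 : F)) 0) ∨
      ((∀ α ∈ Γ, α 0 = 0) ∧ y = X F ℓ Γ j0 0 (Pi.single 0 1))}

/-- The set `A₄`: `x^{2_{[p̄]}}` for `p ∈ I_{1,3}`, `t^{2_{[q̄]}}` for `q ∈ I_{4,6}`, plus
`x^{−2_{[0]}}` if `Γ₀ ≠ {0}`. -/
def A4 (F : Type*) [Field F] (ℓ : ℕ → ℕ) (Γ : AddSubgroup (ℕ → F)) (j0 : Bool) :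
    Set (CA F ℓ Γ j0) :=
  ((fun p => X F ℓ Γ j0 (Pi.single (bar ℓ p) (2 : F)) 0) '' ↑(iSet ℓ 1 3)) ∪
    ((fun q => X F ℓ Γ j0 0 (Pi.single (bar ℓ q) 2)) '' ↑(iSet ℓ 4 6)) ∪
    {y | (∃ α ∈ Γ, α 0 ≠ 0) ∧ y = X F ℓ Γ j0 (Pi.single 0 (-2 : F)) 0}


section helpers

variable {F ℓ Γ j0}

/-- Index type of the basis. -/
abbrev BB (F : Type*) [Field F] (ℓ : ℕ → ℕ) (Γ : AddSubgroup (ℕ → F)) (j0 : Bool) : Type _ :=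
  ↥Γ × ↥(jIdx ℓ j0)

theorem BB_ext {a b : BB F ℓ Γ j0} (h1 : ∀ q, a.1.1 q = b.1.1 q) (h2 : ∀ q, a.2.1 q = b.2.1 q) :
    a = b :=
  Prod.ext (Subtype.ext (funext h1)) (Subtype.ext (funext h2))

/-- Weighted shift operators. -/
def wsh (f : BB F ℓ Γ j0 → F) (φ : BB F ℓ Γ j0 → BB F ℓ Γ j0) :
    Module.End F (CA F ℓ Γ j0) :=
  Finsupp.lsum F (fun b => (f b) • Finsupp.lsingle (φ b))

theorem wsh_single (f : BB F ℓ Γ j0 → F) (φ : BB F ℓ Γ j0 → BB F ℓ Γ j0) (b : BB F ℓ Γ j0)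
    (c : F) : wsh f φ (Finsupp.single b c) = Finsupp.single (φ b) (f b * c) := by
  simp [wsh]

theorem End_ext {A C : Module.End F (CA F ℓ Γ j0)}
    (h : ∀ b, A (Finsupp.single b 1) = C (Finsupp.single b 1)) : A = C := by
  refine Finsupp.lhom_ext' fun b => LinearMap.ext_ring ?_
  simpa using h b

theorem single_congr {a b : BB F ℓ Γ j0} {c c' : F} (h : c = c') (h2 : c ≠ 0 → a = b) :
    (Finsupp.single a c : CA F ℓ Γ j0) = Finsupp.single b c' := by
  subst h
  by_cases hc : c = 0
  · simp [hc]
  · rw [h2 hc]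

theorem wsh_commute {f g : BB F ℓ Γ j0 → F} {φ ψ : BB F ℓ Γ j0 → BB F ℓ Γ j0}
    (h : ∀ b, f b * g (φ b) = g b * f (ψ b))
    (h2 : ∀ b, f b ≠ 0 → g b ≠ 0 → ψ (φ b) = φ (ψ b)) :
    Commute (wsh f φ) (wsh g ψ) := by
  refine End_ext fun b => ?_
  simp only [Module.End.mul_apply, wsh_single, mul_one]
  refine single_congr ?_ ?_
  · rw [mul_comm (f (ψ b)), ← h b, mul_comm]
  · intro h3
    refine (h2 b ?_ ?_).symm
    · intro h0; apply h3
      have := h b; rw [h0, zero_mul] at this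
      rw [mul_comm]; exact this.symm
    · intro h0; apply h3; rw [h0, mul_zero]

/-- Addition of indices. -/
theorem add_mem_jIdx {i j : ℕ → ℕ} (hi : i ∈ jIdx ℓ j0) (hj : j ∈ jIdx ℓ j0) :
    i + j ∈ jIdx ℓ j0 := by
  refine ⟨fun h => by simp [hi.1 h, hj.1 h], fun p hp h => by simp [hi.2 p hp h, hj.2 p hp h]⟩

theorem sub_mem_jIdx {i : ℕ → ℕ} (j : ℕ → ℕ) (hi : i ∈ jIdx ℓ j0) :
    i - j ∈ jIdx ℓ j0 := by
  refine ⟨fun h => by simp [hi.1 h], fun p hp h => by simp [hi.2 p hp h]⟩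

theorem zero_mem_jIdx : (0 : ℕ → ℕ) ∈ jIdx ℓ j0 := ⟨fun _ => rfl, fun _ _ _ => rfl⟩

/-- Sum of indices. -/
def addB (a b : BB F ℓ Γ j0) : BB F ℓ Γ j0 :=
  (⟨a.1.1 + b.1.1, Γ.add_mem a.1.2 b.1.2⟩, ⟨a.2.1 + b.2.1, add_mem_jIdx a.2.2 b.2.2⟩)

/-- Lowering of an index. -/
def low (p : ℕ) (b : BB F ℓ Γ j0) : BB F ℓ Γ j0 :=
  (b.1, ⟨b.2.1 - Pi.single p 1, sub_mem_jIdx _ b.2.2⟩)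

theorem X_eq {α : ℕ → F} {i : ℕ → ℕ} (h1 : α ∈ Γ) (h2 : i ∈ jIdx ℓ j0) :
    X F ℓ Γ j0 α i = Finsupp.single (⟨α, h1⟩, ⟨i, h2⟩) 1 := by
  unfold X
  rw [dif_pos ⟨h1, h2⟩]

theorem mulA_single (a b : BB F ℓ Γ j0) (c c' : F) :
    mulA F ℓ Γ j0 (Finsupp.single a c) (Finsupp.single b c') =
      Finsupp.single (addB a b) (c * c') := by
  unfold mulA
  rw [Finsupp.sum_single_index, Finsupp.sum_single_index]
  · rw [X_eq (Γ.add_mem a.1.2 b.1.2) (add_mem_jIdx a.2.2 b.2.2)]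
    simp [addB]
  · simp
  · simp [Finsupp.sum]

/-- Bilinear form of the product. -/
def mulL : CA F ℓ Γ j0 →ₗ[F] CA F ℓ Γ j0 →ₗ[F] CA F ℓ Γ j0 :=
  LinearMap.mk₂ F (mulA F ℓ Γ j0)
    (by
      intro u v w; unfold mulA
      rw [Finsupp.sum_add_index']
      · simp [Finsupp.sum]
      · intro a c c'; rw [← Finsupp.sum_add]; congr 1; ext; simp [add_mul, add_smul])
    (by
      intro c u v; unfold mulA
      rw [Finsupp.sum_smul_index' (by simp [Finsupp.sum]), Finsupp.smul_sum]
      congr 1; ext1 a; ext1 c'; rw [Finsupp.smul_sum]; congr 1; ext1 b; ext1 c''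
      simp [smul_smul, mul_assoc])
    (by
      intro u v w; unfold mulA
      rw [← Finsupp.sum_add]; congr 1; ext1 a; ext1 c
      rw [Finsupp.sum_add_index']
      · simp
      · intro b c1 c2; simp [mul_add, add_smul])
    (by
      intro c u v; unfold mulA
      rw [Finsupp.smul_sum]; congr 1; ext1 a; ext1 c'
      rw [Finsupp.sum_smul_index' (by simp), Finsupp.smul_sum]
      congr 1; ext1 b; ext1 c''
      simp only [smul_smul, smul_eq_mul]; congr 1; ring)

theorem mulA_eq (u v : CA F ℓ Γ j0) : mulA F ℓ Γ j0 u v = mulL u v := rfl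

theorem mulL_single (a b : BB F ℓ Γ j0) (c c' : F) :
    mulL (Finsupp.single a c : CA F ℓ Γ j0) (Finsupp.single b c') =
      Finsupp.single (addB a b) (c * c') := mulA_single a b c c'

theorem mulL_comm (u v : CA F ℓ Γ j0) : mulL u v = mulL v u := by
  have : (mulL : CA F ℓ Γ j0 →ₗ[F] CA F ℓ Γ j0 →ₗ[F] CA F ℓ Γ j0) = mulL.flip := by
    refine Finsupp.lhom_ext' fun a => LinearMap.ext_ring ?_
    refine Finsupp.lhom_ext' fun b => LinearMap.ext_ring ?_
    simp only [LinearMap.comp_apply, Finsupp.lsingle_apply, LinearMap.flip_apply, mulL_single]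
    congr 1
    exact BB_ext (fun q => by simp [addB, add_comm]) (fun q => by simp [addB, add_comm])
  exact LinearMap.congr_fun₂ this u v

theorem mulL_assoc (u v w : CA F ℓ Γ j0) : mulL u (mulL v w) = mulL (mulL u v) w := by
  induction u using Finsupp.induction_linear with
  | zero => simp
  | add f g hf hg => simp [hf, hg]
  | single a c =>
    induction v using Finsupp.induction_linear with
    | zero => simp
    | add f g hf hg => simp [hf, hg]
    | single b c' =>
      induction w using Finsupp.induction_linear with
      | zero => simp
      | add f g hf hg => simp [hf, hg]
      | single e c'' =>
        simp only [mulL_single, mul_assoc]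
        congr 1
        exact BB_ext (fun q => by simp [addB, add_assoc]) (fun q => by simp [addB, add_assoc])

theorem mulL_single_eq (a : BB F ℓ Γ j0) (v : CA F ℓ Γ j0) :
    mulL (Finsupp.single a 1) v = wsh (fun _ => 1) (addB a) v := by
  have : mulL (Finsupp.single a 1) = wsh (fun _ => (1 : F)) (addB a) :=
    End_ext fun b => by rw [mulL_single, wsh_single]
  rw [this]

/-- Diagonal operators. -/
def dg (f : BB F ℓ Γ j0 → F) : Module.End F (CA F ℓ Γ j0) := wsh f id

theorem dg_single (f : BB F ℓ Γ j0 → F) (b : BB F ℓ Γ j0) (c : F) :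
    dg f (Finsupp.single b c) = Finsupp.single b (f b * c) := wsh_single f id b c

theorem pstar_eq (p : ℕ) (u : CA F ℓ Γ j0) :
    pstar F ℓ Γ j0 p u = dg (fun b => b.1.1 p) u := by
  unfold pstar dg wsh
  rw [Finsupp.lsum_apply]
  congr 1; ext1 a; ext1 c
  simp [mul_comm]

theorem pt_eq (p : ℕ) (u : CA F ℓ Γ j0) :
    pt F ℓ Γ j0 p u = wsh (fun b => (b.2.1 p : F)) (low p) u := by
  unfold pt wsh
  rw [Finsupp.lsum_apply]
  congr 1; ext1 a; ext1 c
  rw [X_eq a.1.2 (sub_mem_jIdx _ a.2.2)]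
  simp [low, mul_comm]

/-- The operator `∂_p`. -/
def ddL (p : ℕ) : Module.End F (CA F ℓ Γ j0) :=
  dg (fun b => b.1.1 p) + wsh (fun b => (b.2.1 p : F)) (low p)

theorem dd_eq (p : ℕ) (u : CA F ℓ Γ j0) : dd F ℓ Γ j0 p u = ddL p u := by
  unfold dd ddL; rw [pstar_eq, pt_eq]; rfl


/-- Exponential-type indices (together with `0`). -/
def ex (ℓ : ℕ → ℕ) (p : ℕ) : Prop := p = 0 ∨ p ∈ jSet ℓ 1 3 ∪ iSet ℓ 4 5

instance (p : ℕ) : Decidable (ex ℓ p) := by unfold ex; infer_instance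

/-- Usable indices. -/
def us (ℓ : ℕ → ℕ) (Γ : AddSubgroup (ℕ → F)) (j0 : Bool) (p : ℕ) : Prop :=
  (ex ℓ p → (Pi.single p (1 : F) : ℕ → F) ∈ Γ) ∧
    (¬ ex ℓ p → (Pi.single p 1 : ℕ → ℕ) ∈ jIdx ℓ j0)

/-- Index with given components (default `b`). -/
def toB (b : BB F ℓ Γ j0) (α : ℕ → F) (i : ℕ → ℕ) : BB F ℓ Γ j0 :=
  @dite _ (α ∈ Γ ∧ i ∈ jIdx ℓ j0) (Classical.dec _) (fun h => (⟨α, h.1⟩, ⟨i, h.2⟩)) (fun _ => b)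

theorem toB_eq (b : BB F ℓ Γ j0) {α : ℕ → F} {i : ℕ → ℕ} (h1 : α ∈ Γ) (h2 : i ∈ jIdx ℓ j0) :
    toB b α i = (⟨α, h1⟩, ⟨i, h2⟩) := by
  unfold toB; rw [dif_pos ⟨h1, h2⟩]

/-- Raise index `p`. -/
def up (p : ℕ) (b : BB F ℓ Γ j0) : BB F ℓ Γ j0 :=
  toB b (b.1.1 + if ex ℓ p then Pi.single p 1 else 0) (b.2.1 + if ex ℓ p then 0 else Pi.single p 1)

/-- Lower index `p`. -/
def dn (p : ℕ) (b : BB F ℓ Γ j0) : BB F ℓ Γ j0 :=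
  toB b (b.1.1 - if ex ℓ p then Pi.single p 1 else 0) (b.2.1 - if ex ℓ p then 0 else Pi.single p 1)

theorem us_fst {p : ℕ} (h : us ℓ Γ j0 p) : (if ex ℓ p then Pi.single p 1 else 0 : ℕ → F) ∈ Γ := by
  split_ifs with h1
  · exact h.1 h1
  · exact Γ.zero_mem

theorem us_snd {p : ℕ} (h : us ℓ Γ j0 p) :
    (if ex ℓ p then 0 else Pi.single p 1 : ℕ → ℕ) ∈ jIdx ℓ j0 := by
  split_ifs with h1
  · exact zero_mem_jIdx
  · exact h.2 h1

theorem up_fst {p : ℕ} (h : us ℓ Γ j0 p) (b : BB F ℓ Γ j0) (q : ℕ) :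
    (up p b).1.1 q = b.1.1 q + if q = p ∧ ex ℓ p then 1 else 0 := by
  unfold up
  rw [toB_eq b (Γ.add_mem b.1.2 (us_fst h)) (add_mem_jIdx b.2.2 (us_snd h))]
  by_cases h1 : ex ℓ p <;> simp [h1, Pi.single_apply]

theorem up_snd {p : ℕ} (h : us ℓ Γ j0 p) (b : BB F ℓ Γ j0) (q : ℕ) :
    (up p b).2.1 q = b.2.1 q + if q = p ∧ ¬ ex ℓ p then 1 else 0 := by
  unfold up
  rw [toB_eq b (Γ.add_mem b.1.2 (us_fst h)) (add_mem_jIdx b.2.2 (us_snd h))]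
  by_cases h1 : ex ℓ p <;> simp [h1, Pi.single_apply]

theorem dn_fst {p : ℕ} (h : us ℓ Γ j0 p) (b : BB F ℓ Γ j0) (q : ℕ) :
    (dn p b).1.1 q = b.1.1 q - if q = p ∧ ex ℓ p then 1 else 0 := by
  unfold dn
  rw [toB_eq b (Γ.sub_mem b.1.2 (us_fst h)) (sub_mem_jIdx _ b.2.2)]
  by_cases h1 : ex ℓ p <;> simp [h1, Pi.single_apply]

theorem dn_snd {p : ℕ} (h : us ℓ Γ j0 p) (b : BB F ℓ Γ j0) (q : ℕ) :
    (dn p b).2.1 q = b.2.1 q - if q = p ∧ ¬ ex ℓ p then 1 else 0 := by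
  unfold dn
  rw [toB_eq b (Γ.sub_mem b.1.2 (us_fst h)) (sub_mem_jIdx _ b.2.2)]
  by_cases h1 : ex ℓ p <;> simp [h1, Pi.single_apply]

theorem low_fst (p : ℕ) (b : BB F ℓ Γ j0) (q : ℕ) : (low p b).1.1 q = b.1.1 q := rfl

theorem low_snd (p : ℕ) (b : BB F ℓ Γ j0) (q : ℕ) :
    (low p b).2.1 q = b.2.1 q - if q = p then 1 else 0 := by
  simp [low, Pi.single_apply]

/-- Semisimple weight. -/
def ss (p : ℕ) (b : BB F ℓ Γ j0) : F := if ex ℓ p then b.1.1 p else (b.2.1 p : F)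

/-- Nilpotent weight. -/
def nu (p : ℕ) (b : BB F ℓ Γ j0) : F := if ex ℓ p then (b.2.1 p : F) else 0

/-- Weight of the lowering shift. -/
def wt (p : ℕ) (b : BB F ℓ Γ j0) : F := if ex ℓ p then 1 else if b.2.1 p = 0 then 0 else 1

/-- Total degree. -/
def deg (b : BB F ℓ Γ j0) : F := ∑ p ∈ Finset.Icc 1 (2 * iot ℓ 6), ss p b

/-- Nilpotent part. -/
def nn (p : ℕ) : Module.End F (CA F ℓ Γ j0) := wsh (nu p) (low p)

/-- Euler-type operators. -/
def ee (p : ℕ) : Module.End F (CA F ℓ Γ j0) := dg (ss p) + nn p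

/-- Raising operator. -/
def Up (p : ℕ) : Module.End F (CA F ℓ Γ j0) := wsh (fun _ => 1) (up p)

/-- Lowering operator. -/
def Dn (p : ℕ) : Module.End F (CA F ℓ Γ j0) := wsh (wt p) (dn p)

theorem ss_up {p : ℕ} (h : us ℓ Γ j0 p) (b : BB F ℓ Γ j0) (q : ℕ) :
    ss q (up p b) = ss q b + if q = p then 1 else 0 := by
  unfold ss
  rw [up_fst h, up_snd h]
  by_cases hq : q = p
  · subst hq; by_cases h1 : ex ℓ q <;> simp [h1]
  · simp [hq]

theorem ss_dn {p : ℕ} (h : us ℓ Γ j0 p) (b : BB F ℓ Γ j0) (hw : wt p b ≠ 0) (q : ℕ) :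
    ss q (dn p b) = ss q b - if q = p then 1 else 0 := by
  unfold ss
  unfold wt at hw
  rw [dn_fst h, dn_snd h]
  by_cases hq : q = p
  · subst hq
    by_cases h1 : ex ℓ q
    · simp [h1]
    · simp only [h1, if_false] at hw ⊢
      have : b.2.1 q ≠ 0 := by intro h0; simp [h0] at hw
      have : 1 ≤ b.2.1 q := Nat.one_le_iff_ne_zero.2 this
      simp [Nat.cast_sub this]
  · simp [hq]

theorem ss_low {p : ℕ} (b : BB F ℓ Γ j0) (hw : nu p b ≠ 0) (q : ℕ) :
    ss q (low p b) = ss q b := by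
  unfold ss
  unfold nu at hw
  rw [low_fst, low_snd]
  by_cases hq : q = p
  · subst hq
    by_cases h1 : ex ℓ q
    · simp [h1]
    · simp [h1] at hw
  · simp [hq]

theorem nu_up {p : ℕ} (h : us ℓ Γ j0 p) (b : BB F ℓ Γ j0) (q : ℕ) : nu q (up p b) = nu q b := by
  unfold nu
  rw [up_snd h]
  by_cases hq : q = p
  · subst hq; by_cases h1 : ex ℓ q <;> simp [h1]
  · simp [hq]

theorem nu_dn {p : ℕ} (h : us ℓ Γ j0 p) (b : BB F ℓ Γ j0) (q : ℕ) : nu q (dn p b) = nu q b := by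
  unfold nu
  rw [dn_snd h]
  by_cases hq : q = p
  · subst hq; by_cases h1 : ex ℓ q <;> simp [h1]
  · simp [hq]

theorem nu_low {p q : ℕ} (hq : q ≠ p) (b : BB F ℓ Γ j0) : nu q (low p b) = nu q b := by
  unfold nu
  rw [low_snd]
  simp [hq]

theorem wt_up {p q : ℕ} (h : us ℓ Γ j0 p) (hq : q ≠ p) (b : BB F ℓ Γ j0) :
    wt q (up p b) = wt q b := by
  unfold wt; rw [up_snd h]; simp [hq]

theorem wt_dn {p q : ℕ} (h : us ℓ Γ j0 p) (hq : q ≠ p) (b : BB F ℓ Γ j0) :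
    wt q (dn p b) = wt q b := by
  unfold wt; rw [dn_snd h]; simp [hq]

theorem wt_low {p q : ℕ} (b : BB F ℓ Γ j0) (hw : nu p b ≠ 0) : wt q (low p b) = wt q b := by
  unfold wt
  unfold nu at hw
  rw [low_snd]
  by_cases hq : q = p
  · subst hq
    by_cases h1 : ex ℓ q
    · simp [h1]
    · simp [h1] at hw
  · simp [hq]

theorem wt_up_self {p : ℕ} (h : us ℓ Γ j0 p) (b : BB F ℓ Γ j0) : wt p (up p b) = 1 := by
  unfold wt; rw [up_snd h]
  by_cases h1 : ex ℓ p <;> simp [h1]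

theorem dg_comm (f g : BB F ℓ Γ j0 → F) : Commute (dg f) (dg g) :=
  wsh_commute (fun b => by simp [mul_comm]) (fun b _ _ => rfl)

theorem dg_nn {f : BB F ℓ Γ j0 → F} (p : ℕ) (h : ∀ b, nu p b ≠ 0 → f (low p b) = f b) :
    Commute (dg f) (nn p) :=
  wsh_commute (fun b => by
    by_cases h0 : nu p b = 0
    · simp [h0]
    · rw [h b h0]; simp [mul_comm]) (fun b _ _ => rfl)

theorem nn_comm (p q : ℕ) : Commute (nn p : Module.End F (CA F ℓ Γ j0)) (nn q) := by
  by_cases h : p = q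
  · subst h; exact Commute.refl _
  · refine wsh_commute (fun b => ?_) (fun b _ _ => ?_)
    · rw [nu_low h, nu_low (Ne.symm h), mul_comm]
    · exact BB_ext (fun r => rfl) (fun r => by simp only [low_snd]; omega)

theorem deg_low {p : ℕ} (b : BB F ℓ Γ j0) (hw : nu p b ≠ 0) : deg (low p b) = deg b :=
  Finset.sum_congr rfl fun q _ => ss_low b hw q

theorem deg_up {p : ℕ} (h : us ℓ Γ j0 p) (b : BB F ℓ Γ j0) :
    deg (up p b) = deg b + if p ∈ Finset.Icc 1 (2 * iot ℓ 6) then 1 else 0 := by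
  unfold deg
  simp only [ss_up h, Finset.sum_add_distrib, Finset.sum_ite_eq']

theorem deg_dn {p : ℕ} (h : us ℓ Γ j0 p) (b : BB F ℓ Γ j0) (hw : wt p b ≠ 0) :
    deg (dn p b) = deg b - if p ∈ Finset.Icc 1 (2 * iot ℓ 6) then 1 else 0 := by
  unfold deg
  simp only [ss_dn h b hw, Finset.sum_sub_distrib, Finset.sum_ite_eq']

theorem ss_nn (p q : ℕ) : Commute (dg (ss p) : Module.End F (CA F ℓ Γ j0)) (nn q) :=
  dg_nn q fun b hb => ss_low b hb p

theorem degf_nn (f : F → F) (q : ℕ) :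
    Commute (dg (fun b => f (deg b)) : Module.End F (CA F ℓ Γ j0)) (nn q) :=
  dg_nn q fun b hb => by rw [deg_low b hb]

theorem degf_ee (f : F → F) (q : ℕ) :
    Commute (dg (fun b => f (deg b)) : Module.End F (CA F ℓ Γ j0)) (ee q) :=
  (dg_comm _ _).add_right (degf_nn f q)

theorem nn_ee (p q : ℕ) : Commute (nn p : Module.End F (CA F ℓ Γ j0)) (ee q) :=
  (ss_nn q p).symm.add_right (nn_comm p q)

theorem ee_comm (p q : ℕ) : Commute (ee p : Module.End F (CA F ℓ Γ j0)) (ee q) :=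
  ((dg_comm _ _).add_right (ss_nn p q)).add_left (nn_ee p q)

theorem dgs_Up {p : ℕ} (h : us ℓ Γ j0 p) (f : BB F ℓ Γ j0 → F) (c : F)
    (hf : ∀ b, f (up p b) = f b + c) :
    dg f * Up p = Up p * (dg f + c • 1) := by
  refine End_ext fun b => ?_
  simp only [Module.End.mul_apply, Up, dg_single, wsh_single, LinearMap.add_apply,
    LinearMap.smul_apply, Module.End.one_apply, Finsupp.smul_single, ← Finsupp.single_add, hf]
  simp

theorem dgs_Dn {p : ℕ} (h : us ℓ Γ j0 p) (f : BB F ℓ Γ j0 → F) (c : F)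
    (hf : ∀ b, wt p b ≠ 0 → f (dn p b) = f b - c) :
    dg f * Dn p = Dn p * (dg f - c • 1) := by
  refine End_ext fun b => ?_
  simp only [Module.End.mul_apply, Dn, dg_single, wsh_single, LinearMap.sub_apply,
    LinearMap.smul_apply, Module.End.one_apply, Finsupp.smul_single, ← Finsupp.single_sub]
  refine single_congr ?_ fun _ => rfl
  by_cases hw : wt p b = 0
  · simp [hw]
  · rw [hf b hw]; simp [mul_comm]

theorem nn_Up {p : ℕ} (h : us ℓ Γ j0 p) (q : ℕ) :
    Commute (nn q : Module.End F (CA F ℓ Γ j0)) (Up p) := by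
  refine wsh_commute (fun b => by rw [nu_up h, mul_comm]) (fun b hb _ => ?_)
  refine BB_ext (fun r => ?_) (fun r => ?_)
  · simp only [low_fst, up_fst h]
  · simp only [low_snd, up_snd h]
    unfold nu at hb
    have : ex ℓ q := by by_contra h1; simp [h1] at hb
    by_cases h2 : r = q
    · subst h2
      by_cases h3 : r = p
      · subst h3; simp [this]
      · simp [h3]
    · simp [h2]

theorem nn_Dn {p : ℕ} (h : us ℓ Γ j0 p) (q : ℕ) :
    Commute (nn q : Module.End F (CA F ℓ Γ j0)) (Dn p) := by
  refine wsh_commute (fun b => ?_) (fun b hb _ => ?_)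
  · by_cases h0 : nu q b = 0
    · simp [h0, nu_dn h]
    · rw [nu_dn h, wt_low b h0, mul_comm]
  refine BB_ext (fun r => ?_) (fun r => ?_)
  · simp only [low_fst, dn_fst h]
  · simp only [low_snd, dn_snd h]
    omega

theorem ee_Up {p : ℕ} (h : us ℓ Γ j0 p) (q : ℕ) :
    (ee q : Module.End F (CA F ℓ Γ j0)) * Up p = Up p * (ee q + (if q = p then 1 else 0 : F) • 1) := by
  unfold ee
  rw [add_mul, dgs_Up h _ _ (fun b => ss_up h b q), (nn_Up h q).eq, ← mul_add]
  congr 1; abel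

theorem ee_Dn {p : ℕ} (h : us ℓ Γ j0 p) (q : ℕ) :
    (ee q : Module.End F (CA F ℓ Γ j0)) * Dn p = Dn p * (ee q - (if q = p then 1 else 0 : F) • 1) := by
  unfold ee
  rw [add_mul, dgs_Dn h _ _ (fun b hb => ss_dn h b hb q), (nn_Dn h q).eq, ← mul_add]
  congr 1; abel

theorem Up_Up {p q : ℕ} (h : us ℓ Γ j0 p) (h' : us ℓ Γ j0 q) :
    Commute (Up p : Module.End F (CA F ℓ Γ j0)) (Up q) := by
  refine wsh_commute (fun b => rfl) (fun b _ _ => BB_ext (fun r => ?_) (fun r => ?_))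
  · simp only [up_fst h, up_fst h']; ring
  · simp only [up_snd h, up_snd h']; ring

theorem Dn_Dn {p q : ℕ} (h : us ℓ Γ j0 p) (h' : us ℓ Γ j0 q) (hpq : p ≠ q) :
    Commute (Dn p : Module.End F (CA F ℓ Γ j0)) (Dn q) := by
  refine wsh_commute (fun b => ?_) (fun b _ _ => BB_ext (fun r => ?_) (fun r => ?_))
  · rw [wt_dn h hpq.symm, wt_dn h' hpq, mul_comm]
  · simp only [dn_fst h, dn_fst h']; ring
  · simp only [dn_snd h, dn_snd h']; omega

theorem Up_Dn {p q : ℕ} (h : us ℓ Γ j0 p) (h' : us ℓ Γ j0 q) (hpq : p ≠ q) :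
    Commute (Up p : Module.End F (CA F ℓ Γ j0)) (Dn q) := by
  refine wsh_commute (fun b => ?_) (fun b _ _ => BB_ext (fun r => ?_) (fun r => ?_))
  · rw [wt_up h hpq.symm, mul_comm]
  · simp only [dn_fst h', up_fst h]; ring
  · simp only [dn_snd h', up_snd h]
    by_cases hr : r = p
    · have : r ≠ q := by omega
      simp [this]
    · simp [hr]

theorem Dn_Up_self {p : ℕ} (h : us ℓ Γ j0 p) :
    (Dn p : Module.End F (CA F ℓ Γ j0)) * Up p = 1 := by
  refine End_ext fun b => ?_
  simp only [Module.End.mul_apply, Dn, Up, wsh_single, Module.End.one_apply, wt_up_self h, mul_one]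
  congr 1
  refine BB_ext (fun r => ?_) (fun r => ?_)
  · simp only [dn_fst h, up_fst h]; ring
  · simp only [dn_snd h, up_snd h]; omega

theorem Up_Dn_single {p : ℕ} (h : us ℓ Γ j0 p) (b : BB F ℓ Γ j0) (c : F) (hw : c ≠ 0 → wt p b ≠ 0) :
    Up p (Dn p (Finsupp.single b c : CA F ℓ Γ j0)) = Finsupp.single b c := by
  simp only [Dn, Up, wsh_single]
  have h1 : c ≠ 0 → wt p b = 1 := by
    intro hc
    have := hw hc
    unfold wt at this ⊢
    split_ifs at this ⊢ <;> simp_all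
  have h2 : wt p b * c = c := by
    by_cases hc : c = 0
    · simp [hc]
    · rw [h1 hc, one_mul]
  rw [h2, one_mul]
  refine single_congr rfl fun hc => ?_
  have hw := hw hc
  refine BB_ext (fun r => ?_) (fun r => ?_)
  · simp only [dn_fst h, up_fst h]; ring
  · simp only [dn_snd h, up_snd h]
    unfold wt at hw
    by_cases h3 : ex ℓ p
    · simp [h3]
    · simp only [h3, if_false] at hw
      by_cases h4 : r = p
      · subst h4
        have : b.2.1 r ≠ 0 := by intro h0; simp [h0] at hw
        simp [h3]; omega
      · simp [h4]

theorem Up_Dn_apply {p : ℕ} (h : us ℓ Γ j0 p) (w : CA F ℓ Γ j0)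
    (hw : ∀ b, w b ≠ 0 → wt p b ≠ 0) : Up p (Dn p w) = w := by
  conv_lhs => rw [← Finsupp.sum_single w]
  conv_rhs => rw [← Finsupp.sum_single w]
  unfold Finsupp.sum
  rw [map_sum, map_sum]
  exact Finset.sum_congr rfl fun b _ => Up_Dn_single h b _ (hw b)

theorem Up_Dn_ee {p : ℕ} (h : us ℓ Γ j0 p) :
    (Up p : Module.End F (CA F ℓ Γ j0)) * Dn p * ee p = ee p := by
  refine End_ext fun b => ?_
  simp only [Module.End.mul_apply, ee, nn, LinearMap.add_apply, dg_single, wsh_single, map_add]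
  congr 1
  · refine Up_Dn_single h _ _ ?_
    unfold ss wt
    by_cases h3 : ex ℓ p
    · simp [h3]
    · by_cases h4 : b.2.1 p = 0 <;> simp [h3, h4]
  · refine Up_Dn_single h _ _ ?_
    unfold nu wt
    by_cases h3 : ex ℓ p
    · simp [h3]
    · simp [h3]

/-- Total nilpotent operator. -/
def NN : Module.End F (CA F ℓ Γ j0) := ∑ p ∈ Finset.Icc 1 (2 * iot ℓ 6), nn p

theorem NN_ee (q : ℕ) : Commute (NN : Module.End F (CA F ℓ Γ j0)) (ee q) :=
  Commute.sum_left _ _ _ fun p _ => nn_ee p q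

theorem degf_NN (f : F → F) :
    Commute (dg (fun b => f (deg b)) : Module.End F (CA F ℓ Γ j0)) NN :=
  Commute.sum_right _ _ _ fun p _ => degf_nn f p

theorem sum_ee : ∑ p ∈ Finset.Icc 1 (2 * iot ℓ 6), (ee p : Module.End F (CA F ℓ Γ j0)) =
    dg deg + NN := by
  unfold ee NN
  rw [Finset.sum_add_distrib]
  congr 1
  refine End_ext fun b => ?_
  rw [LinearMap.sum_apply]
  simp only [dg_single, deg, mul_one]
  exact (Finsupp.single_finsetSum _ _ _).symm

/-- Total polynomial degree. -/
def tau (b : BB F ℓ Γ j0) : ℕ := ∑ p ∈ Finset.Icc 1 (2 * iot ℓ 6), b.2.1 p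

theorem NN_pow_single (K : ℕ) : ∀ (b : BB F ℓ Γ j0) (c : F), tau b < K →
    (NN ^ K : Module.End F (CA F ℓ Γ j0)) (Finsupp.single b c) = 0 := by
  induction K with
  | zero => intro b c h; omega
  | succ K ih =>
    intro b c h
    rw [pow_succ, Module.End.mul_apply]
    conv_lhs => enter [2]; unfold NN
    rw [LinearMap.sum_apply, map_sum]
    refine Finset.sum_eq_zero fun p hp => ?_
    unfold nn
    rw [wsh_single]
    by_cases h0 : nu p b = 0
    · simp [h0]
    · apply ih
      have h1 : b.2.1 p ≠ 0 := by
        intro h1; apply h0; unfold nu; simp [h1]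
      have : tau (low p b) < tau b := by
        unfold tau
        refine Finset.sum_lt_sum (fun q _ => ?_) ⟨p, hp, ?_⟩
        · rw [low_snd]; omega
        · rw [low_snd]; simp; omega
      omega

theorem NN_nil (v : CA F ℓ Γ j0) : ∃ K : ℕ, ∀ K' ≥ K, (NN ^ K') v = 0 := by
  refine ⟨v.support.sup tau + 1, fun K' hK => ?_⟩
  conv_lhs => rw [← Finsupp.sum_single v]
  unfold Finsupp.sum
  rw [map_sum]
  refine Finset.sum_eq_zero fun b hb => NN_pow_single _ _ _ ?_
  have : tau b ≤ v.support.sup tau := Finset.le_sup hb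
  omega


/-- Joint kernel of the weight operators. -/
def inV (x : CA F ℓ Γ j0) : Prop :=
  (∀ q ∈ Finset.Icc 1 (iot ℓ 6), ee (q + iot ℓ 6) x = ee q x) ∧ ee 0 x = 0

theorem inV_map {x : CA F ℓ Γ j0} (hx : inV x) (A : Module.End F (CA F ℓ Γ j0))
    (hA : ∀ q, Commute A (ee q)) : inV (A x) := by
  have key : ∀ q y, ee q (A y) = A (ee q y) := fun q y => by
    rw [← Module.End.mul_apply, ← (hA q).eq, Module.End.mul_apply]
  refine ⟨fun q hq => ?_, ?_⟩
  · rw [key, key, hx.1 q hq]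
  · rw [key, hx.2, map_zero]

theorem inV_add {x y : CA F ℓ Γ j0} (hx : inV x) (hy : inV y) : inV (x + y) :=
  ⟨fun q hq => by rw [map_add, map_add, hx.1 q hq, hy.1 q hq], by rw [map_add, hx.2, hy.2, add_zero]⟩

theorem inV_neg {x : CA F ℓ Γ j0} (hx : inV x) : inV (-x) :=
  ⟨fun q hq => by rw [map_neg, map_neg, hx.1 q hq], by rw [map_neg, hx.2, neg_zero]⟩

theorem inV_zero : inV (0 : CA F ℓ Γ j0) := ⟨fun q _ => by simp, by simp⟩

theorem inV_sum {s : Finset ℕ} {v : ℕ → CA F ℓ Γ j0} (h : ∀ p ∈ s, inV (v p)) :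
    inV (∑ p ∈ s, v p) := by
  classical
  induction s using Finset.induction_on with
  | empty => simpa using inV_zero
  | insert a s ha ih =>
    rw [Finset.sum_insert ha]
    exact inV_add (h a (Finset.mem_insert_self a s))
      (ih fun p hp => h p (Finset.mem_insert_of_mem hp))

theorem sum_double {M : Type*} [AddCommMonoid M] (n : ℕ) (f : ℕ → M) :
    ∑ p ∈ Finset.Icc 1 (2 * n), f p = ∑ p ∈ Finset.Icc 1 n, (f p + f (p + n)) := by
  have h : Finset.Icc 1 (2 * n) = Finset.Icc 1 n ∪ (Finset.Icc 1 n).image (· + n) := by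
    ext x; simp only [Finset.mem_union, Finset.mem_Icc, Finset.mem_image]
    constructor
    · intro hx
      by_cases h : x ≤ n
      · left; omega
      · right; exact ⟨x - n, by omega, by omega⟩
    · rintro (h | ⟨y, h, rfl⟩) <;> omega
  rw [h, Finset.sum_union, Finset.sum_image, Finset.sum_add_distrib]
  · intro a _ b _ hab; simpa using hab
  · rw [Finset.disjoint_left]; intro x hx hx'
    simp only [Finset.mem_Icc, Finset.mem_image] at hx hx'
    obtain ⟨y, hy, rfl⟩ := hx'; omega

theorem sum_E_V [CharZero F] {x : CA F ℓ Γ j0} (hx : inV x) :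
    ∑ p ∈ Finset.Icc 1 (iot ℓ 6), ee (p + iot ℓ 6) x =
      (2⁻¹ : F) • (dg deg x + NN x) := by
  have h := congrArg (fun A : Module.End F (CA F ℓ Γ j0) => A x) (sum_ee (F := F) (ℓ := ℓ) (Γ := Γ) (j0 := j0))
  simp only [LinearMap.sum_apply, LinearMap.add_apply] at h
  rw [← h, sum_double, Finset.smul_sum]
  refine Finset.sum_congr rfl fun p hp => ?_
  rw [← hx.1 p hp, ← two_smul F, smul_smul, inv_mul_cancel₀ two_ne_zero, one_smul]

theorem Q_exists (K : ℕ) : ∃ Q : Module.End F (CA F ℓ Γ j0),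
    (∀ A : Module.End F (CA F ℓ Γ j0), Commute A NN → Commute A Q) ∧
    ∀ x, (NN ^ K) x = 0 → Q (x + (2⁻¹ : F) • NN x) = x := by
  refine ⟨∑ k ∈ Finset.range K, ((-(2⁻¹) : F) • NN) ^ k, fun A hA =>
    Commute.sum_right _ _ _ fun k _ => (hA.smul_right _).pow_right k, fun x hx => ?_⟩
  have hQ := geom_sum_mul_neg ((-(2⁻¹) : F) • (NN : Module.End F (CA F ℓ Γ j0))) K
  have h1 : x + (2⁻¹ : F) • NN x =
      (1 - (-(2⁻¹) : F) • (NN : Module.End F (CA F ℓ Γ j0))) x := by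
    simp only [LinearMap.sub_apply, LinearMap.smul_apply, Module.End.one_apply, neg_smul]
    rw [sub_neg_eq_add]
  rw [h1, ← Module.End.mul_apply, hQ, LinearMap.sub_apply, Module.End.one_apply, smul_pow,
    LinearMap.smul_apply, hx, smul_zero, sub_zero]

/-- Projection to degree two. -/
def fP (c : F) : F := @ite _ (c = 2) (Classical.dec _) 1 0

/-- Inverse of `deg - 2`. -/
def fG (c : F) : F := (c - 2)⁻¹

theorem fP_mul (c : F) : c * fP c = 2 * fP c := by
  unfold fP; split_ifs with h
  · rw [h]
  · simp

theorem fG_mul (c : F) : c * fG c - 2 * fG c = 1 - fP c := by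
  unfold fP fG; split_ifs with h
  · simp [h]
  · have : c - 2 ≠ 0 := sub_ne_zero.2 h
    rw [← sub_mul, mul_inv_cancel₀ this, sub_zero]

theorem TP_eq : dg deg * dg (fun b => fP (deg b)) =
    (2 : F) • (dg (fun b => fP (deg b)) : Module.End F (CA F ℓ Γ j0)) := by
  refine End_ext fun b => ?_
  rw [Module.End.mul_apply, LinearMap.smul_apply, dg_single, dg_single, Finsupp.smul_single,
    smul_eq_mul, mul_one, fP_mul]

theorem TG_eq : dg deg * dg (fun b => fG (deg b)) - (2 : F) • dg (fun b => fG (deg b)) =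
    (1 - dg (fun b => fP (deg b)) : Module.End F (CA F ℓ Γ j0)) := by
  refine End_ext fun b => ?_
  rw [LinearMap.sub_apply, LinearMap.sub_apply, Module.End.mul_apply, LinearMap.smul_apply,
    dg_single, dg_single, dg_single, Finsupp.smul_single, Module.End.one_apply, smul_eq_mul,
    mul_one, mul_one, ← Finsupp.single_sub, ← Finsupp.single_sub, fG_mul]

theorem PG_exists : ∃ P G : Module.End F (CA F ℓ Γ j0),
    (∀ q, Commute P (ee q)) ∧ (∀ q, Commute G (ee q)) ∧ Commute P NN ∧
    Commute (dg deg) P ∧ Commute (dg deg) G ∧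
    (∀ x, dg deg (P x) = (2 : F) • P x) ∧ (∀ x, dg deg (G x) - (2 : F) • G x = x - P x) :=
  ⟨dg (fun b => fP (deg b)), dg (fun b => fG (deg b)), fun q => degf_ee fP q,
    fun q => degf_ee fG q, degf_NN fP, dg_comm _ _, dg_comm _ _,
    fun x => LinearMap.congr_fun TP_eq x, fun x => LinearMap.congr_fun TG_eq x⟩

theorem solve [CharZero F] (v : ℕ → CA F ℓ Γ j0) (v0 : CA F ℓ Γ j0)
    (hv : ∀ p ∈ Finset.Icc 1 (iot ℓ 6), inV (v p)) (hv0 : inV v0)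
    (hc : ∀ p ∈ Finset.Icc 1 (iot ℓ 6), ∀ q ∈ Finset.Icc 1 (iot ℓ 6),
      ee (q + iot ℓ 6) (v p) = ee (p + iot ℓ 6) (v q))
    (hc0 : ∀ p ∈ Finset.Icc 1 (iot ℓ 6),
      dg deg (v p) - (2 : F) • v p = ee (p + iot ℓ 6) v0) :
    ∃ u, inV u ∧ dg deg u - (2 : F) • u = -v0 ∧
      ∀ p ∈ Finset.Icc 1 (iot ℓ 6), ee (p + iot ℓ 6) u = - v p := by
  classical
  set I := Finset.Icc 1 (iot ℓ 6) with hI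
  obtain ⟨P, G, hPE, hGE, hPN, hTPc, hTGc, hTP, hTG⟩ := PG_exists (F := F) (ℓ := ℓ) (Γ := Γ) (j0 := j0)
  have hTN : Commute (dg deg : Module.End F (CA F ℓ Γ j0)) NN := degf_NN (fun c => c)
  -- nilpotency bound
  obtain ⟨K0, hK0⟩ := NN_nil v0
  choose Kf hKf using fun p => NN_nil (v p)
  obtain ⟨K, hKdef⟩ : ∃ K, K = K0 + I.sup Kf := ⟨_, rfl⟩
  have hK0' : (NN ^ K) v0 = 0 := hK0 K (by omega)
  have hKp : ∀ p ∈ I, (NN ^ K) (v p) = 0 := fun p hp => hKf p K (by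
    have : Kf p ≤ I.sup Kf := Finset.le_sup hp
    omega)
  obtain ⟨Q, hMcomm, hQ⟩ := Q_exists (F := F) (ℓ := ℓ) (Γ := Γ) (j0 := j0) K
  have ap : ∀ {A C : Module.End F (CA F ℓ Γ j0)}, Commute A C → ∀ x, A (C x) = C (A x) :=
    fun {A C} h x => by rw [← Module.End.mul_apply, h.eq, Module.End.mul_apply]
  have inv : ∀ x, inV x → (NN ^ K) x = 0 → Q (P (∑ p ∈ I, ee (p + iot ℓ 6) x)) = P x := by
    intro x hx hK
    rw [sum_E_V hx, map_smul, map_add, ← ap hTPc, hTP, ap hPN, smul_add, smul_smul,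
      inv_mul_cancel₀ two_ne_zero, one_smul]
    apply hQ
    rw [← ap (hPN.pow_right K), hK, map_zero]
  have hPv0 : P v0 = 0 := by
    rw [← inv v0 hv0 hK0']
    have : P (∑ p ∈ I, ee (p + iot ℓ 6) v0) = 0 := by
      rw [map_sum]
      refine Finset.sum_eq_zero fun p hp => ?_
      rw [← hc0 p hp, map_sub, map_smul, ← ap hTPc, hTP, sub_self]
    rw [this, map_zero]
  have hQE : ∀ q, Commute Q (ee q) := fun q => (hMcomm _ (NN_ee q).symm).symm
  have hQT : Commute (dg deg) Q := hMcomm _ hTN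
  refine ⟨-G v0 + -(Q (P (∑ p ∈ I, v p))), ?_, ?_, ?_⟩
  · exact inV_add (inV_neg (inV_map hv0 G hGE))
      (inV_neg (inV_map (inV_map (inV_sum hv) P hPE) Q hQE))
  · rw [map_add, map_neg, map_neg, ap hQT, hTP, map_smul, smul_add, smul_neg, smul_neg]
    have := hTG v0
    rw [hPv0, sub_zero] at this
    conv_rhs => rw [← this]
    abel
  · intro q hq
    rw [map_add, map_neg, map_neg, ← ap (hGE _), ← ap (hQE _), ← ap (hPE _), map_sum]
    rw [Finset.sum_congr rfl fun p hp => hc p hp q hq, inv _ (hv q hq) (hKp q hq),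
      ← hc0 q hq, map_sub, map_smul, ← ap hTGc, hTG]
    abel


/-- Standing assumptions. -/
structure Good (F : Type*) [Field F] (ℓ : ℕ → ℕ) (Γ : AddSubgroup (ℕ → F)) : Prop where
  h1 : ∀ p ∈ jSet ℓ 1 3 ∪ iSet ℓ 4 5, (Pi.single p (1 : F) : ℕ → F) ∈ Γ
  h2 : ∀ α ∈ Γ, ∀ p ∈ iSet ℓ 6 6 ∪ barSet ℓ (iSet ℓ 4 6), α p = 0

theorem iot_zero : iot ℓ 0 = 0 := by simp [iot]

theorem iot_mono (n : ℕ) : iot ℓ n ≤ iot ℓ (n + 1) := by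
  unfold iot
  exact Finset.sum_le_sum_of_subset (Finset.Icc_subset_Icc_right (Nat.le_succ n))

theorem iot_chain : iot ℓ 0 = 0 ∧ iot ℓ 0 ≤ iot ℓ 1 ∧ iot ℓ 1 ≤ iot ℓ 2 ∧ iot ℓ 2 ≤ iot ℓ 3 ∧
    iot ℓ 3 ≤ iot ℓ 4 ∧ iot ℓ 4 ≤ iot ℓ 5 ∧ iot ℓ 5 ≤ iot ℓ 6 :=
  ⟨iot_zero, iot_mono 0, iot_mono 1, iot_mono 2, iot_mono 3, iot_mono 4, iot_mono 5⟩

theorem mem_iSet (i j p : ℕ) : p ∈ iSet ℓ i j ↔ iot ℓ (i - 1) + 1 ≤ p ∧ p ≤ iot ℓ j := by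
  simp [iSet]

theorem bar_le {p : ℕ} (h : p ≤ iot ℓ 6) : bar ℓ p = p + iot ℓ 6 := by simp [bar, h]

theorem mem_barSet (i j p : ℕ) (hj : iot ℓ j ≤ iot ℓ 6) : p ∈ barSet ℓ (iSet ℓ i j) ↔
    iot ℓ (i - 1) + iot ℓ 6 + 1 ≤ p ∧ p ≤ iot ℓ j + iot ℓ 6 := by
  unfold barSet
  simp only [Finset.mem_image, mem_iSet]
  constructor
  · rintro ⟨a, ha, rfl⟩
    rw [bar_le (by omega)]; omega
  · intro h
    refine ⟨p - iot ℓ 6, by omega, ?_⟩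
    rw [bar_le (by omega)]; omega

theorem ex_iff (p : ℕ) : ex ℓ p ↔ p = 0 ∨ (1 ≤ p ∧ p ≤ iot ℓ 5) ∨
    (iot ℓ 6 + 1 ≤ p ∧ p ≤ iot ℓ 6 + iot ℓ 3) := by
  have := iot_chain (ℓ := ℓ)
  unfold ex jSet
  simp only [Finset.mem_union, mem_barSet (ℓ := ℓ) 1 3 p (by omega), mem_iSet]
  norm_num
  omega

theorem tt_iff (p : ℕ) : p ∈ iSet ℓ 6 6 ∪ barSet ℓ (iSet ℓ 4 6) ↔
    (iot ℓ 5 + 1 ≤ p ∧ p ≤ iot ℓ 6) ∨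
    (iot ℓ 6 + iot ℓ 3 + 1 ≤ p ∧ p ≤ 2 * iot ℓ 6) := by
  have := iot_chain (ℓ := ℓ)
  simp only [Finset.mem_union, mem_barSet (ℓ := ℓ) 4 6 p (by omega), mem_iSet]
  norm_num
  omega

theorem et_eq : jSet ℓ 1 3 ∪ iSet ℓ 4 5 = (Finset.Icc 1 (2 * iot ℓ 6)).filter (ex ℓ) := by
  have := iot_chain (ℓ := ℓ)
  ext p
  have h : p ∈ jSet ℓ 1 3 ∪ iSet ℓ 4 5 ↔ p ≠ 0 ∧ ex ℓ p := by
    unfold ex jSet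
    simp only [Finset.mem_union, mem_barSet (ℓ := ℓ) 1 3 p (by omega), mem_iSet]
    norm_num
    omega
  rw [h, Finset.mem_filter, Finset.mem_Icc, ex_iff]
  omega

theorem tt_eq : iSet ℓ 6 6 ∪ barSet ℓ (iSet ℓ 4 6) =
    (Finset.Icc 1 (2 * iot ℓ 6)).filter (fun p => ¬ ex ℓ p) := by
  have := iot_chain (ℓ := ℓ)
  ext p
  rw [tt_iff, Finset.mem_filter, Finset.mem_Icc, ex_iff]
  omega

theorem us_of (H : Good F ℓ Γ) {p : ℕ} (hp : p ∈ Finset.Icc 1 (2 * iot ℓ 6)) : us ℓ Γ j0 p := by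
  refine ⟨fun h => H.h1 p ?_, fun h => ⟨fun _ => ?_, fun q hq h' => ?_⟩⟩
  · rw [et_eq, Finset.mem_filter]; exact ⟨hp, h⟩
  · rw [Finset.mem_Icc] at hp
    rw [Pi.single_apply, if_neg (by omega)]
  · have := iot_chain (ℓ := ℓ)
    have : p ∈ iSet ℓ 6 6 ∪ barSet ℓ (iSet ℓ 4 6) := by
      rw [tt_eq, Finset.mem_filter]; exact ⟨hp, h⟩
    rw [tt_iff] at this
    rw [Pi.single_apply, if_neg]
    rintro rfl
    simp only [Finset.mem_union, mem_barSet (ℓ := ℓ) 1 1 q (by omega), mem_iSet] at h'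
    norm_num at h'
    omega

theorem alpha_zero (H : Good F ℓ Γ) {p : ℕ} (hp : p ∈ Finset.Icc 1 (2 * iot ℓ 6))
    (h : ¬ ex ℓ p) (b : BB F ℓ Γ j0) : b.1.1 p = 0 := by
  refine H.h2 _ b.1.2 p ?_
  rw [tt_eq, Finset.mem_filter]; exact ⟨hp, h⟩

theorem sgm_eq {p : ℕ} (hp : p ∈ Finset.Icc 1 (iot ℓ 6)) :
    sgm F ℓ p = -(if ex ℓ p then Pi.single p 1 else 0) -
      (if ex ℓ (p + iot ℓ 6) then Pi.single (p + iot ℓ 6) 1 else 0) := by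
  have := iot_chain (ℓ := ℓ)
  rw [Finset.mem_Icc] at hp
  unfold sgm
  simp only [hp.2, if_true]
  by_cases h1 : p ∈ iSet ℓ 1 3
  · rw [if_pos h1]
    rw [mem_iSet] at h1
    norm_num at h1
    rw [if_pos ((ex_iff p).2 (by omega)), if_pos ((ex_iff _).2 (by omega))]
  · rw [if_neg h1]
    rw [mem_iSet] at h1
    norm_num at h1
    rw [if_neg (c := ex ℓ (p + iot ℓ 6)) (by rw [ex_iff]; omega), sub_zero]
    by_cases h2 : p ∈ iSet ℓ 4 5
    · rw [if_pos h2]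
      rw [mem_iSet] at h2
      rw [if_pos ((ex_iff p).2 (by omega))]
    · rw [if_neg h2]
      rw [mem_iSet] at h2
      norm_num at h2
      rw [if_neg (by rw [ex_iff]; omega), neg_zero]

/-- Zero index. -/
def zB : BB F ℓ Γ j0 := (0, ⟨0, zero_mem_jIdx⟩)

theorem zB_fst (q : ℕ) : (zB : BB F ℓ Γ j0).1.1 q = 0 := rfl

theorem zB_snd (q : ℕ) : (zB : BB F ℓ Γ j0).2.1 q = 0 := rfl

theorem addB_fst (a b : BB F ℓ Γ j0) (q : ℕ) : (addB a b).1.1 q = a.1.1 q + b.1.1 q := rfl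

theorem addB_snd (a b : BB F ℓ Γ j0) (q : ℕ) : (addB a b).2.1 q = a.2.1 q + b.2.1 q := rfl

theorem Dop_eq (H : Good F ℓ Γ) (u : CA F ℓ Γ j0) : Dop F ℓ Γ j0 u = dg deg u := by
  have h2 : ∀ p ∈ iSet ℓ 6 6 ∪ barSet ℓ (iSet ℓ 4 6),
      mulA F ℓ Γ j0 (X F ℓ Γ j0 0 (Pi.single p 1)) (pt F ℓ Γ j0 p u) = dg (ss p) u := by
    intro p hp
    rw [tt_eq, Finset.mem_filter] at hp
    rw [X_eq Γ.zero_mem ((us_of H hp.1).2 hp.2), mulA_eq, mulL_single_eq, pt_eq,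
      ← Module.End.mul_apply]
    congr 1
    refine End_ext fun b => ?_
    simp only [Module.End.mul_apply, wsh_single, dg_single, ss, hp.2, if_false, one_mul]
    refine single_congr rfl fun hb => ?_
    refine BB_ext (fun r => ?_) (fun r => ?_)
    · simp [addB_fst, low_fst]
    · simp only [addB_snd, low_snd, Pi.single_apply]
      by_cases hr : r = p
      · subst hr
        have : b.2.1 r ≠ 0 := by intro h0; simp [h0] at hb
        simp; omega
      · simp [hr]
  have h1 : ∀ p ∈ jSet ℓ 1 3 ∪ iSet ℓ 4 5, pstar F ℓ Γ j0 p u = dg (ss p) u := by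
    intro p hp
    rw [et_eq, Finset.mem_filter] at hp
    rw [pstar_eq]
    congr 1
    refine End_ext fun b => ?_
    simp only [dg_single, ss, hp.2, if_true]
  unfold Dop
  rw [Finset.sum_congr rfl h1, Finset.sum_congr rfl h2, et_eq, tt_eq,
    Finset.sum_filter_add_sum_filter_not, ← LinearMap.sum_apply]
  congr 1
  refine End_ext fun b => ?_
  rw [LinearMap.sum_apply]
  simp only [dg_single, deg, mul_one]
  exact (Finsupp.single_finsetSum _ _ _).symm

theorem iSet16 : iSet ℓ 1 6 = Finset.Icc 1 (iot ℓ 6) := by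
  unfold iSet; norm_num [iot_zero]

theorem brk_eq (H : Good F ℓ Γ) (u v : CA F ℓ Γ j0) : brk F ℓ Γ j0 u v =
    (∑ p ∈ Finset.Icc 1 (iot ℓ 6),
      (mulL (mulL (X F ℓ Γ j0 (sgm F ℓ p) 0) (ddL p u)) (ddL (p + iot ℓ 6) v) -
       mulL (mulL (X F ℓ Γ j0 (sgm F ℓ p) 0) (ddL (p + iot ℓ 6) u)) (ddL p v))) +
    mulL ((2 : F) • u - dg deg u) (ddL 0 v) - mulL (ddL 0 u) ((2 : F) • v - dg deg v) := by
  unfold brk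
  simp only [mulA_eq, dd_eq, Dop_eq H, iSet16]
  congr 2
  refine Finset.sum_congr rfl fun p hp => ?_
  rw [Finset.mem_Icc] at hp
  rw [bar_le hp.2, map_sub, mulL_assoc, mulL_assoc]

theorem brk_anti (H : Good F ℓ Γ) (u v : CA F ℓ Γ j0) :
    brk F ℓ Γ j0 u v = - brk F ℓ Γ j0 v u := by
  rw [brk_eq H, brk_eq H, mulL_comm _ (ddL 0 v), mulL_comm (ddL 0 u)]
  have : ∀ p ∈ Finset.Icc 1 (iot ℓ 6),
      (mulL (mulL (X F ℓ Γ j0 (sgm F ℓ p) 0) (ddL p u)) (ddL (p + iot ℓ 6) v) -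
       mulL (mulL (X F ℓ Γ j0 (sgm F ℓ p) 0) (ddL (p + iot ℓ 6) u)) (ddL p v)) =
      - (mulL (mulL (X F ℓ Γ j0 (sgm F ℓ p) 0) (ddL p v)) (ddL (p + iot ℓ 6) u) -
       mulL (mulL (X F ℓ Γ j0 (sgm F ℓ p) 0) (ddL (p + iot ℓ 6) v)) (ddL p u)) := by
    intro p _
    rw [← mulL_assoc, ← mulL_assoc, ← mulL_assoc, ← mulL_assoc, mulL_comm (ddL p u),
      mulL_comm (ddL p v)]
    abel
  rw [Finset.sum_congr rfl this, Finset.sum_neg_distrib]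
  abel

theorem brk_zero_left (H : Good F ℓ Γ) (v : CA F ℓ Γ j0) : brk F ℓ Γ j0 0 v = 0 := by
  rw [brk_eq H]; simp


/-- The unit. -/
def one1 : CA F ℓ Γ j0 := Finsupp.single zB 1

theorem ee_one (q : ℕ) : ee q (one1 : CA F ℓ Γ j0) = 0 := by
  unfold one1 ee nn
  rw [LinearMap.add_apply, dg_single, wsh_single]
  have h1 : ss q (zB : BB F ℓ Γ j0) = 0 := by unfold ss; simp [zB_fst, zB_snd]
  have h2 : nu q (zB : BB F ℓ Γ j0) = 0 := by unfold nu; simp [zB_snd]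
  simp [h1, h2]

theorem deg_one : dg deg (one1 : CA F ℓ Γ j0) = 0 := by
  unfold one1
  rw [dg_single]
  have h1 : deg (zB : BB F ℓ Γ j0) = 0 := by
    unfold deg
    refine Finset.sum_eq_zero fun q _ => ?_
    unfold ss; simp [zB_fst, zB_snd]
  simp [h1]

theorem mulL_one (v : CA F ℓ Γ j0) : mulL one1 v = v := by
  unfold one1
  rw [mulL_single_eq]
  have : wsh (fun _ => (1 : F)) (addB (zB : BB F ℓ Γ j0)) = 1 := by
    refine End_ext fun b => ?_
    rw [wsh_single, Module.End.one_apply, mul_one]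
    congr 1
    refine BB_ext (fun r => ?_) (fun r => ?_)
    · rw [addB_fst, zB_fst, zero_add]
    · rw [addB_snd, zB_snd, zero_add]
  rw [this, Module.End.one_apply]

theorem Up_eq {p : ℕ} (h : us ℓ Γ j0 p) (v : CA F ℓ Γ j0) :
    Up p v = mulL (Finsupp.single (up p zB) 1) v := by
  rw [mulL_single_eq]
  have : (Up p : Module.End F (CA F ℓ Γ j0)) = wsh (fun _ => (1 : F)) (addB (up p zB)) := by
    refine End_ext fun b => ?_
    unfold Up
    rw [wsh_single, wsh_single]
    congr 1
    refine BB_ext (fun r => ?_) (fun r => ?_)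
    · rw [addB_fst, up_fst h, up_fst h, zB_fst]; ring
    · rw [addB_snd, up_snd h, up_snd h, zB_snd]; ring
  rw [this]

theorem mulL_Up {p : ℕ} (h : us ℓ Γ j0 p) (u v : CA F ℓ Γ j0) :
    mulL (Up p u) v = Up p (mulL u v) := by
  rw [Up_eq h, Up_eq h, mulL_assoc]

/-- Index of the correction monomial. -/
def mB (p : ℕ) : BB F ℓ Γ j0 := if ex ℓ p then dn p zB else zB

theorem mB_fst {p : ℕ} (h : us ℓ Γ j0 p) (q : ℕ) :
    (mB p : BB F ℓ Γ j0).1.1 q = - if q = p ∧ ex ℓ p then 1 else 0 := by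
  unfold mB
  by_cases h1 : ex ℓ p
  · simp only [h1, if_true, dn_fst h, zB_fst, zero_sub]
  · simp [h1, zB_fst]

theorem mB_snd {p : ℕ} (h : us ℓ Γ j0 p) (q : ℕ) :
    (mB p : BB F ℓ Γ j0).2.1 q = 0 := by
  unfold mB
  by_cases h1 : ex ℓ p
  · simp only [h1, if_true, dn_snd h, zB_snd, Nat.zero_sub]
  · simp [h1, zB_snd]

theorem mB_dd (H : Good F ℓ Γ) {r : ℕ} (hr : r ∈ Finset.Icc 1 (2 * iot ℓ 6)) (v : CA F ℓ Γ j0) :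
    mulL (Finsupp.single (mB r) 1) (ddL r v) = Dn r (ee r v) := by
  have h : us ℓ Γ j0 r := us_of H hr
  rw [mulL_single_eq, ← Module.End.mul_apply, ← Module.End.mul_apply]
  congr 1
  refine End_ext fun b => ?_
  unfold ddL Dn ee nn
  simp only [Module.End.mul_apply, LinearMap.add_apply, map_add, dg_single, wsh_single, mul_one,
    one_mul]
  by_cases h1 : ex ℓ r
  · congr 1
    · refine single_congr ?_ fun _ => ?_
      · simp [ss, wt, h1]
      · refine BB_ext (fun q => ?_) (fun q => ?_)
        · rw [addB_fst, mB_fst h, dn_fst h]; ring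
        · rw [addB_snd, mB_snd h, dn_snd h]; simp [h1]
    · refine single_congr ?_ fun _ => ?_
      · simp [nu, wt, h1]
      · refine BB_ext (fun q => ?_) (fun q => ?_)
        · rw [addB_fst, mB_fst h, dn_fst h, low_fst]; ring
        · rw [addB_snd, mB_snd h, dn_snd h, low_snd]; simp [h1]
  · rw [alpha_zero H hr h1 b]
    have h2 : nu r b = 0 := by simp [nu, h1]
    rw [h2, Finsupp.single_zero, mul_zero, Finsupp.single_zero, zero_add, add_zero]
    refine single_congr ?_ fun _ => ?_
    · by_cases h3 : b.2.1 r = 0 <;> simp [ss, wt, h1, h3]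
    · refine BB_ext (fun q => ?_) (fun q => ?_)
      · rw [addB_fst, mB_fst h, dn_fst h, low_fst]; simp [h1]
      · rw [addB_snd, mB_snd h, dn_snd h, low_snd]; simp [h1]

theorem sgm_mB (H : Good F ℓ Γ) {p : ℕ} (hp : p ∈ Finset.Icc 1 (iot ℓ 6)) :
    X F ℓ Γ j0 (sgm F ℓ p) 0 =
      mulL (Finsupp.single (mB p) 1) (Finsupp.single (mB (p + iot ℓ 6)) 1) := by
  have hp' := Finset.mem_Icc.1 hp
  have h : us ℓ Γ j0 p := us_of H (Finset.mem_Icc.2 (by omega))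
  have h' : us ℓ Γ j0 (p + iot ℓ 6) := us_of H (Finset.mem_Icc.2 (by omega))
  have hm : sgm F ℓ p ∈ Γ := by
    rw [sgm_eq hp]
    exact Γ.sub_mem (Γ.neg_mem (us_fst h)) (us_fst h')
  rw [X_eq hm zero_mem_jIdx, mulL_single, mul_one]
  congr 1
  refine BB_ext (fun q => ?_) (fun q => ?_)
  · rw [addB_fst, mB_fst h, mB_fst h']
    change sgm F ℓ p q = _
    rw [sgm_eq hp]
    by_cases h1 : ex ℓ p <;> by_cases h2 : ex ℓ (p + iot ℓ 6) <;>
      simp [h1, h2, Pi.single_apply, sub_eq_add_neg]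
  · rw [addB_snd, mB_snd h, mB_snd h']; rfl

theorem dd_zero : (ddL 0 : Module.End F (CA F ℓ Γ j0)) = ee 0 := by
  have h : ex ℓ 0 := (ex_iff 0).2 (Or.inl rfl)
  refine End_ext fun b => ?_
  unfold ddL ee nn
  simp only [LinearMap.add_apply, dg_single, wsh_single, ss, nu, h, if_true]

theorem brk_op (H : Good F ℓ Γ) (u v : CA F ℓ Γ j0) : brk F ℓ Γ j0 u v =
    (∑ p ∈ Finset.Icc 1 (iot ℓ 6),
      (mulL (Dn p (ee p u)) (Dn (p + iot ℓ 6) (ee (p + iot ℓ 6) v)) -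
       mulL (Dn (p + iot ℓ 6) (ee (p + iot ℓ 6) u)) (Dn p (ee p v)))) +
    mulL ((2 : F) • u - dg deg u) (ee 0 v) - mulL (ee 0 u) ((2 : F) • v - dg deg v) := by
  rw [brk_eq H, dd_zero]
  congr 2
  refine Finset.sum_congr rfl fun p hp => ?_
  have hp' := Finset.mem_Icc.1 hp
  have h : p ∈ Finset.Icc 1 (2 * iot ℓ 6) := (Finset.mem_Icc.2 (by omega))
  have h' : p + iot ℓ 6 ∈ Finset.Icc 1 (2 * iot ℓ 6) := (Finset.mem_Icc.2 (by omega))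
  rw [sgm_mB H hp, ← mB_dd H h, ← mB_dd H h', ← mB_dd H h, ← mB_dd H h']
  congr 1
  · rw [mulL_comm (Finsupp.single (mB p) 1) (Finsupp.single (mB (p + iot ℓ 6)) 1),
      ← mulL_assoc (Finsupp.single (mB (p + iot ℓ 6)) 1), mulL_assoc _ _ (ddL (p + iot ℓ 6) v),
      mulL_comm (Finsupp.single (mB (p + iot ℓ 6)) 1)]
  · rw [← mulL_assoc (Finsupp.single (mB p) 1), mulL_assoc _ _ (ddL p v),
      mulL_comm (Finsupp.single (mB p) 1)]

theorem ee_Up_ne {p q : ℕ} (h : us ℓ Γ j0 p) (hq : q ≠ p) (u : CA F ℓ Γ j0) :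
    ee q (Up p u) = Up p (ee q u) := by
  have := LinearMap.congr_fun (ee_Up h q) u
  simpa [hq] using this

theorem ee_Up_self {p : ℕ} (h : us ℓ Γ j0 p) (u : CA F ℓ Γ j0) :
    ee p (Up p u) = Up p (ee p u) + Up p u := by
  have := LinearMap.congr_fun (ee_Up h p) u
  simpa using this

theorem ee_Dn_ne {p q : ℕ} (h : us ℓ Γ j0 p) (hq : q ≠ p) (u : CA F ℓ Γ j0) :
    ee q (Dn p u) = Dn p (ee q u) := by
  have := LinearMap.congr_fun (ee_Dn h q) u
  simpa [hq] using this

theorem ee_Dn_self {p : ℕ} (h : us ℓ Γ j0 p) (u : CA F ℓ Γ j0) :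
    ee p (Dn p u) = Dn p (ee p u) - Dn p u := by
  have := LinearMap.congr_fun (ee_Dn h p) u
  simpa using this

theorem Dn_Up_app {p : ℕ} (h : us ℓ Γ j0 p) (u : CA F ℓ Γ j0) : Dn p (Up p u) = u :=
  LinearMap.congr_fun (Dn_Up_self h) u

theorem UDe {p : ℕ} (h : us ℓ Γ j0 p) (u : CA F ℓ Γ j0) : Up p (Dn p (ee p u)) = ee p u :=
  LinearMap.congr_fun (Up_Dn_ee h) u

theorem degUp {p : ℕ} (h : us ℓ Γ j0 p) (hp : p ∈ Finset.Icc 1 (2 * iot ℓ 6)) (u : CA F ℓ Γ j0) :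
    dg deg (Up p u) = Up p (dg deg u) + Up p u := by
  have := LinearMap.congr_fun (dgs_Up h deg 1 (fun b => by rw [deg_up h, if_pos hp])) u
  simpa using this

theorem degUp0 (h : us ℓ Γ j0 0) (u : CA F ℓ Γ j0) :
    dg deg (Up 0 u) = Up 0 (dg deg u) := by
  have := LinearMap.congr_fun (dgs_Up h deg 0 (fun b => by rw [deg_up h, if_neg (by simp)])) u
  simpa using this

theorem degDn {p : ℕ} (h : us ℓ Γ j0 p) (hp : p ∈ Finset.Icc 1 (2 * iot ℓ 6)) (u : CA F ℓ Γ j0) :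
    dg deg (Dn p u) = Dn p (dg deg u) - Dn p u := by
  have := LinearMap.congr_fun (dgs_Dn h deg 1 (fun b hb => by rw [deg_dn h b hb, if_pos hp])) u
  simpa using this

theorem degDn0 (h : us ℓ Γ j0 0) (u : CA F ℓ Γ j0) :
    dg deg (Dn 0 u) = Dn 0 (dg deg u) := by
  have := LinearMap.congr_fun (dgs_Dn h deg 0 (fun b hb => by rw [deg_dn h b hb, if_neg (by simp)])) u
  simpa using this

/-- The element `h_p`. -/
def hE (p : ℕ) : CA F ℓ Γ j0 := Up p (Up (p + iot ℓ 6) one1)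

/-- The element `y_p`. -/
def yE (p : ℕ) : CA F ℓ Γ j0 := Up p (Up p one1)

theorem brk_one (H : Good F ℓ Γ) (v : CA F ℓ Γ j0) : brk F ℓ Γ j0 one1 v = (2 : F) • ee 0 v := by
  rw [brk_op H]
  simp only [ee_one, deg_one, map_zero, LinearMap.zero_apply, sub_zero, Finset.sum_const_zero,
    zero_add, map_smul, LinearMap.smul_apply, mulL_one]

theorem idx (H : Good F ℓ Γ) {p : ℕ} (hp : p ∈ Finset.Icc 1 (iot ℓ 6)) :
    us ℓ Γ j0 p ∧ us ℓ Γ j0 (p + iot ℓ 6) ∧ p ∈ Finset.Icc 1 (2 * iot ℓ 6) ∧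
      p + iot ℓ 6 ∈ Finset.Icc 1 (2 * iot ℓ 6) ∧ p ≠ 0 ∧ p + iot ℓ 6 ≠ 0 ∧ p ≠ p + iot ℓ 6 := by
  have hp' := Finset.mem_Icc.1 hp
  refine ⟨us_of H (Finset.mem_Icc.2 (by omega)), us_of H (Finset.mem_Icc.2 (by omega)),
    Finset.mem_Icc.2 (by omega), Finset.mem_Icc.2 (by omega), by omega, by omega, by omega⟩

theorem brk_h (H : Good F ℓ Γ) {p : ℕ} (hp : p ∈ Finset.Icc 1 (iot ℓ 6)) (v : CA F ℓ Γ j0) :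
    brk F ℓ Γ j0 (hE p) v = ee (p + iot ℓ 6) v - ee p v := by
  obtain ⟨h, h', hJ, hJ', h0, h0', hne⟩ := idx (j0 := j0) H hp
  have hp' := Finset.mem_Icc.1 hp
  rw [brk_op H, Finset.sum_eq_single_of_mem p hp]
  · have e1 : ee 0 (hE p : CA F ℓ Γ j0) = 0 := by
      unfold hE; rw [ee_Up_ne h h0.symm, ee_Up_ne h' h0'.symm, ee_one]; simp
    have e2 : Dn p (ee p (hE p : CA F ℓ Γ j0)) = Up (p + iot ℓ 6) one1 := by
      unfold hE; rw [ee_Up_self h, ee_Up_ne h' hne, ee_one]; simp [Dn_Up_app h]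
    have e3 : Dn (p + iot ℓ 6) (ee (p + iot ℓ 6) (hE p : CA F ℓ Γ j0)) = Up p one1 := by
      unfold hE
      rw [← Module.End.mul_apply (Up p), (Up_Up h h').eq, Module.End.mul_apply,
        ee_Up_self h', ee_Up_ne h hne.symm, ee_one]; simp [Dn_Up_app h']
    have e4 : dg deg (hE p : CA F ℓ Γ j0) = (2 : F) • hE p := by
      unfold hE; rw [degUp h hJ, degUp h' hJ', deg_one, two_smul]; simp
    rw [e1, e2, e3, e4, mulL_Up h', mulL_Up h, mulL_one, mulL_one, UDe h, UDe h']
    simp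
  · intro q hq hqp
    have hq' := Finset.mem_Icc.1 hq
    have e1 : ee q (hE p : CA F ℓ Γ j0) = 0 := by
      unfold hE; rw [ee_Up_ne h hqp, ee_Up_ne h' (by omega), ee_one]; simp
    have e2 : ee (q + iot ℓ 6) (hE p : CA F ℓ Γ j0) = 0 := by
      unfold hE; rw [ee_Up_ne h (by omega), ee_Up_ne h' (by omega), ee_one]; simp
    rw [e1, e2]; simp

theorem ee_y_ne {p q : ℕ} (h : us ℓ Γ j0 p) (hq : q ≠ p) : ee q (yE p : CA F ℓ Γ j0) = 0 := by
  unfold yE; rw [ee_Up_ne h hq, ee_Up_ne h hq, ee_one]; simp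

theorem ee_y_self {p : ℕ} (h : us ℓ Γ j0 p) : ee p (yE p : CA F ℓ Γ j0) = (2 : F) • yE p := by
  unfold yE; rw [ee_Up_self h, ee_Up_self h, ee_one, two_smul]; simp

theorem brk_y (H : Good F ℓ Γ) {p : ℕ} (hp : p ∈ Finset.Icc 1 (iot ℓ 6)) (v : CA F ℓ Γ j0) :
    brk F ℓ Γ j0 (yE p) v = (2 : F) • Up p (Dn (p + iot ℓ 6) (ee (p + iot ℓ 6) v)) := by
  obtain ⟨h, h', hJ, hJ', h0, h0', hne⟩ := idx (j0 := j0) H hp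
  have hp' := Finset.mem_Icc.1 hp
  rw [brk_op H, Finset.sum_eq_single_of_mem p hp]
  · have e2 : Dn p (ee p (yE p : CA F ℓ Γ j0)) = (2 : F) • Up p one1 := by
      rw [ee_y_self h, map_smul]; unfold yE; rw [Dn_Up_app h]
    have e4 : dg deg (yE p : CA F ℓ Γ j0) = (2 : F) • yE p := by
      unfold yE; rw [degUp h hJ, degUp h hJ, deg_one, two_smul]; simp
    rw [ee_y_ne h h0.symm, e2, ee_y_ne h hne.symm, e4, map_smul, LinearMap.smul_apply,
      mulL_Up h, mulL_one]
    simp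
  · intro q hq hqp
    have hq' := Finset.mem_Icc.1 hq
    rw [ee_y_ne h hqp, ee_y_ne h (show q + iot ℓ 6 ≠ p by omega)]; simp

theorem brk_y0 (H : Good F ℓ Γ) (h : us ℓ Γ j0 0) (v : CA F ℓ Γ j0) (hv : ee 0 v = 0) :
    brk F ℓ Γ j0 (yE 0) v = (2 : F) • Up 0 (Up 0 (dg deg v - (2 : F) • v)) := by
  rw [brk_op H, Finset.sum_eq_zero, hv, ee_y_self h]
  · unfold yE
    rw [map_smul, LinearMap.smul_apply, mulL_Up h, mulL_Up h, mulL_one]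
    simp only [map_zero, map_sub, zero_add, zero_sub, smul_sub]
    abel
  · intro q hq
    have hq' := Finset.mem_Icc.1 hq
    rw [ee_y_ne h (show q ≠ 0 by omega), ee_y_ne h (show q + iot ℓ 6 ≠ 0 by omega)]; simp

/-- Index of `t₀`. -/
theorem t0_mem (hj : j0 = true) : (Pi.single 0 1 : ℕ → ℕ) ∈ jIdx ℓ j0 := by
  refine ⟨fun h => by simp [hj] at h, fun p hp _ => ?_⟩
  rw [Pi.single_apply, if_neg (by omega)]

/-- The element `t₀`. -/
def tE : CA F ℓ Γ j0 := X F ℓ Γ j0 0 (Pi.single 0 1)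

theorem ee_t_ne (hj : j0 = true) {q : ℕ} (hq : q ≠ 0) : ee q (tE : CA F ℓ Γ j0) = 0 := by
  unfold tE ee nn
  rw [X_eq Γ.zero_mem (t0_mem hj), LinearMap.add_apply, dg_single, wsh_single]
  simp [ss, nu, hq]

theorem ee_t (hj : j0 = true) : ee 0 (tE : CA F ℓ Γ j0) = one1 := by
  have h : ex ℓ 0 := (ex_iff 0).2 (Or.inl rfl)
  unfold tE ee nn one1
  rw [X_eq Γ.zero_mem (t0_mem hj), LinearMap.add_apply, dg_single, wsh_single]
  simp only [ss, nu, h, if_true, Pi.zero_apply, zero_mul, Finsupp.single_zero, zero_add,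
    Pi.single_eq_same, Nat.cast_one, mul_one]
  congr 1
  refine BB_ext (fun q => rfl) (fun q => ?_)
  rw [low_snd, zB_snd]
  by_cases hq : q = 0 <;> simp [hq]

theorem brk_t (H : Good F ℓ Γ) (hj : j0 = true) (v : CA F ℓ Γ j0) (hv : ee 0 v = 0) :
    brk F ℓ Γ j0 tE v = dg deg v - (2 : F) • v := by
  rw [brk_op H, Finset.sum_eq_zero, hv, ee_t hj, mulL_one]
  · simp
  · intro q hq
    have hq' := Finset.mem_Icc.1 hq
    rw [ee_t_ne hj (show q ≠ 0 by omega), ee_t_ne hj (show q + iot ℓ 6 ≠ 0 by omega)]; simp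

theorem dg_apply (f : BB F ℓ Γ j0 → F) (w : CA F ℓ Γ j0) (b : BB F ℓ Γ j0) :
    dg f w b = f b * w b := by
  classical
  induction w using Finsupp.induction_linear with
  | zero => simp
  | add u v hu hv => rw [map_add, Finsupp.add_apply, hu, hv, Finsupp.add_apply, mul_add]
  | single a c =>
    rw [dg_single, Finsupp.single_apply, Finsupp.single_apply]
    by_cases h : a = b
    · subst h; simp
    · simp [h]

theorem ee_apply {p : ℕ} (h : ¬ ex ℓ p) (w : CA F ℓ Γ j0) (b : BB F ℓ Γ j0) :
    ee p w b = (b.2.1 p : F) * w b := by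
  have h1 : (nn p : Module.End F (CA F ℓ Γ j0)) = 0 := by
    refine End_ext fun b => ?_
    unfold nn; rw [wsh_single]; simp [nu, h]
  unfold ee
  rw [h1, add_zero, dg_apply]
  simp [ss, h]

theorem UpDn_w [CharZero F] (H : Good F ℓ Γ) {p : ℕ} (hp : p ∈ Finset.Icc 1 (iot ℓ 6))
    (w : CA F ℓ Γ j0) (hw : ee (p + iot ℓ 6) w - ee p w = (-2 : F) • w) : Up p (Dn p w) = w := by
  obtain ⟨h, h', hJ, hJ', h0, h0', hne⟩ := idx (j0 := j0) H hp
  refine Up_Dn_apply h w fun b hb => ?_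
  by_cases h1 : ex ℓ p
  · simp [wt, h1]
  · have h2 : ¬ ex ℓ (p + iot ℓ 6) := by
      have hc := iot_chain (ℓ := ℓ)
      have hp' := Finset.mem_Icc.1 hp
      rw [ex_iff] at h1 ⊢
      omega
    have := DFunLike.congr_fun hw b
    rw [Finsupp.sub_apply, ee_apply h1, ee_apply h2, Finsupp.smul_apply, smul_eq_mul,
      ← sub_mul] at this
    have h3 := mul_right_cancel₀ hb this
    have h4 : b.2.1 p ≠ 0 := by
      intro h0
      rw [h0] at h3
      have : ((b.2.1 (p + iot ℓ 6) + 2 : ℕ) : F) = 0 := by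
        push_cast; push_cast at h3; linear_combination h3
      exact absurd (Nat.cast_eq_zero.1 this) (by omega)
    simp [wt, h1, h4]

set_option maxHeartbeats 2000000 in
theorem core [CharZero F] (H : Good F ℓ Γ) (d : CA F ℓ Γ j0 →ₗ[F] CA F ℓ Γ j0)
    (hd : ∀ u v : CA F ℓ Γ j0,
      d (brk F ℓ Γ j0 u v) = brk F ℓ Γ j0 (d u) v + brk F ℓ Γ j0 u (d v))
    (hdh : ∀ p ∈ Finset.Icc 1 (iot ℓ 6), d (hE p) = 0) (hd1 : d one1 = 0)
    (y0 : CA F ℓ Γ j0) (L0 R0 : Module.End F (CA F ℓ Γ j0))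
    (hy0 : ∀ v, ee 0 v = 0 → brk F ℓ Γ j0 y0 v = L0 (dg deg v - (2 : F) • v))
    (hRL : ∀ v, R0 (L0 v) = v) (hLR : ∀ v, L0 (R0 v) = v)
    (hRe : ∀ q ∈ Finset.Icc 1 (2 * iot ℓ 6), ∀ v, ee q (R0 v) = R0 (ee q v))
    (hRU : ∀ q ∈ Finset.Icc 1 (2 * iot ℓ 6), ∀ v, Up q (R0 v) = R0 (Up q v))
    (hRD : ∀ q ∈ Finset.Icc 1 (2 * iot ℓ 6), ∀ v, Dn q (R0 v) = R0 (Dn q v))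
    (hyq : ∀ q ∈ Finset.Icc 1 (2 * iot ℓ 6), ee q y0 = 0)
    (h00 : ee 0 (R0 (d y0)) = 0) :
    ∃ u : CA F ℓ Γ j0, inV u ∧ (∀ p ∈ Finset.Icc 1 (iot ℓ 6), brk F ℓ Γ j0 u (yE p) = d (yE p)) ∧
      brk F ℓ Γ j0 u y0 = d y0 := by
  have two_ne : (2 : F) ≠ 0 := two_ne_zero
  -- weights of the images
  have W1 : ∀ q ∈ Finset.Icc 1 (iot ℓ 6), ∀ p ∈ Finset.Icc 1 (iot ℓ 6), q ≠ p →
      ee (q + iot ℓ 6) (d (yE p)) = ee q (d (yE p)) := by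
    intro q hq p hp hqp
    have hp' := Finset.mem_Icc.1 hp
    have hq' := Finset.mem_Icc.1 hq
    obtain ⟨h, -⟩ := idx (j0 := j0) H hp
    have := hd (hE q) (yE p)
    rw [brk_h H hq, brk_h H hq, hdh q hq, brk_zero_left H, ee_y_ne h hqp,
      ee_y_ne h (show q + iot ℓ 6 ≠ p by omega), sub_zero, map_zero, zero_add] at this
    exact sub_eq_zero.1 this.symm
  have W1' : ∀ p ∈ Finset.Icc 1 (iot ℓ 6),
      ee (p + iot ℓ 6) (d (yE p)) - ee p (d (yE p)) = (-2 : F) • d (yE p) := by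
    intro p hp
    obtain ⟨h, h', hJ, hJ', h0, h0', hne⟩ := idx (j0 := j0) H hp
    have := hd (hE p) (yE p)
    rw [brk_h H hp, brk_h H hp, hdh p hp, brk_zero_left H, ee_y_self h,
      ee_y_ne h hne.symm, zero_sub, map_neg, map_smul, zero_add] at this
    rw [← this, neg_smul]
  have W2 : ∀ p ∈ Finset.Icc 1 (iot ℓ 6), ee 0 (d (yE p)) = 0 := by
    intro p hp
    obtain ⟨h, h', hJ, hJ', h0, h0', hne⟩ := idx (j0 := j0) H hp
    have := hd one1 (yE p)
    rw [brk_one H, brk_one H, hd1, brk_zero_left H, ee_y_ne h h0.symm, smul_zero, map_zero,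
      zero_add] at this
    exact (smul_eq_zero.1 this.symm).resolve_left two_ne
  have W0 : ∀ q ∈ Finset.Icc 1 (iot ℓ 6), ee (q + iot ℓ 6) (d y0) = ee q (d y0) := by
    intro q hq
    obtain ⟨h, h', hJ, hJ', h0, h0', hne⟩ := idx (j0 := j0) H hq
    have := hd (hE q) y0
    rw [brk_h H hq, brk_h H hq, hdh q hq, brk_zero_left H, hyq q hJ, hyq _ hJ', sub_zero, map_zero,
      zero_add] at this
    exact sub_eq_zero.1 this.symm
  obtain ⟨v, hv⟩ : ∃ v : ℕ → CA F ℓ Γ j0,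
      ∀ p, v p = (2⁻¹ : F) • Up (p + iot ℓ 6) (Dn p (d (yE p))) := ⟨_, fun p => rfl⟩
  have V1 : ∀ p ∈ Finset.Icc 1 (iot ℓ 6), inV (v p) := by
    intro p hp
    obtain ⟨h, h', hJ, hJ', h0, h0', hne⟩ := idx (j0 := j0) H hp
    have hp' := Finset.mem_Icc.1 hp
    refine ⟨fun q hq => ?_, ?_⟩
    · have hq' := Finset.mem_Icc.1 hq
      rw [hv, map_smul, map_smul]
      refine congrArg (fun z => (2⁻¹ : F) • z) ?_
      by_cases hqp : q = p
      · subst hqp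
        rw [ee_Up_self h', ee_Dn_ne h hne.symm, ee_Up_ne h' hne, ee_Dn_self h,
          ← map_add, ← map_add, ← map_sub]
        have := W1' q hq
        rw [sub_eq_iff_eq_add] at this
        rw [this]
        congr 2
        module
      · rw [ee_Up_ne h' (show q + iot ℓ 6 ≠ p + iot ℓ 6 by omega),
          ee_Dn_ne h (show q + iot ℓ 6 ≠ p by omega), ee_Up_ne h' (show q ≠ p + iot ℓ 6 by omega),
          ee_Dn_ne h hqp, W1 q hq p hp hqp]
    · rw [hv, map_smul, ee_Up_ne h' h0'.symm, ee_Dn_ne h h0.symm, W2 p hp]; simp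
  have V0 : inV (R0 (d y0)) := by
    refine ⟨fun q hq => ?_, h00⟩
    obtain ⟨h, h', hJ, hJ', h0, h0', hne⟩ := idx (j0 := j0) H hq
    rw [hRe _ hJ', hRe _ hJ, W0 q hq]
  have hc : ∀ p ∈ Finset.Icc 1 (iot ℓ 6), ∀ q ∈ Finset.Icc 1 (iot ℓ 6),
      ee (q + iot ℓ 6) (v p) = ee (p + iot ℓ 6) (v q) := by
    intro p hp q hq
    by_cases hpq : p = q
    · rw [hpq]
    obtain ⟨h, h', hJ, hJ', h0, h0', hne⟩ := idx (j0 := j0) H hp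
    obtain ⟨g, g', gJ, gJ', g0, g0', gne⟩ := idx (j0 := j0) H hq
    have hp' := Finset.mem_Icc.1 hp
    have hq' := Finset.mem_Icc.1 hq
    have E := hd (yE p) (yE q)
    rw [brk_y H hp, ee_y_ne g (show p + iot ℓ 6 ≠ q by omega), map_zero, map_zero, smul_zero,
      map_zero, brk_anti H (d (yE p)), brk_y H hq, brk_y H hp, eq_comm, neg_add_eq_zero] at E
    have E := smul_right_injective _ two_ne E
    rw [hv, hv, map_smul, map_smul]
    refine congrArg (fun z => (2⁻¹ : F) • z) ?_
    rw [ee_Up_ne h' (show q + iot ℓ 6 ≠ p + iot ℓ 6 by omega),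
      ee_Dn_ne h (show q + iot ℓ 6 ≠ p by omega),
      ee_Up_ne g' (show p + iot ℓ 6 ≠ q + iot ℓ 6 by omega),
      ee_Dn_ne g (show p + iot ℓ 6 ≠ q by omega)]
    have c1 : Up (q + iot ℓ 6) (Dn q (Up q (Dn (q + iot ℓ 6) (ee (q + iot ℓ 6) (d (yE p)))))) =
        ee (q + iot ℓ 6) (d (yE p)) := by rw [Dn_Up_app g, UDe g']
    have c2 : Up (p + iot ℓ 6) (Dn p (Up p (Dn (p + iot ℓ 6) (ee (p + iot ℓ 6) (d (yE q)))))) =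
        ee (p + iot ℓ 6) (d (yE q)) := by rw [Dn_Up_app h, UDe h']
    rw [← c1, ← c2, E]
    have cm : Commute (Up (p + iot ℓ 6) * Dn p : Module.End F (CA F ℓ Γ j0))
        (Up (q + iot ℓ 6) * Dn q) := by
      refine Commute.mul_left (Commute.mul_right (Up_Up h' g') (Up_Dn h' g (by omega)))
        (Commute.mul_right (Up_Dn g' h (by omega)).symm (Dn_Dn h g hpq))
    exact LinearMap.congr_fun cm.eq _
  have hc0 : ∀ p ∈ Finset.Icc 1 (iot ℓ 6),
      dg deg (v p) - (2 : F) • v p = ee (p + iot ℓ 6) (R0 (d y0)) := by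
    intro p hp
    obtain ⟨h, h', hJ, hJ', h0, h0', hne⟩ := idx (j0 := j0) H hp
    have E := hd (yE p) y0
    rw [brk_y H hp, hyq _ hJ', map_zero, map_zero, smul_zero, map_zero, brk_anti H (d (yE p)),
      hy0 _ (W2 p hp), brk_y H hp, eq_comm, neg_add_eq_zero] at E
    have E := congrArg R0 E
    rw [hRL, map_smul, ← hRU _ hJ, ← hRD _ hJ', ← hRe _ hJ'] at E
    have e1 : dg deg (Up (p + iot ℓ 6) (Dn p (d (yE p)))) =
        Up (p + iot ℓ 6) (Dn p (dg deg (d (yE p)))) := by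
      rw [degUp h' hJ', degDn h hJ, map_sub]; abel
    have e2 : dg deg (v p) - (2 : F) • v p =
        (2⁻¹ : F) • Up (p + iot ℓ 6) (Dn p (dg deg (d (yE p)) - (2 : F) • d (yE p))) := by
      rw [hv, map_smul, e1]; simp only [map_sub, map_smul, smul_sub]
      rw [smul_comm]
    rw [e2, E]
    simp only [map_smul]
    rw [smul_smul, inv_mul_cancel₀ two_ne, one_smul, Dn_Up_app h, UDe h']
  obtain ⟨u, hu, hu0, hup⟩ := solve v (R0 (d y0)) V1 V0 hc hc0
  refine ⟨u, hu, fun p hp => ?_, ?_⟩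
  · obtain ⟨h, h', hJ, hJ', h0, h0', hne⟩ := idx (j0 := j0) H hp
    rw [brk_anti H, brk_y H hp, hup p hp, hv]
    simp only [map_neg, map_smul, smul_neg, neg_neg]
    rw [Dn_Up_app h', UpDn_w H hp _ (W1' p hp), smul_smul, mul_inv_cancel₀ two_ne, one_smul]
  · rw [brk_anti H, hy0 u hu.2, hu0, map_neg, neg_neg, hLR]

theorem hE_X (H : Good F ℓ Γ) {p : ℕ} (hp : p ∈ Finset.Icc 1 (iot ℓ 6)) :
    hE p = X F ℓ Γ j0 (-sgm F ℓ p) ((if ex ℓ p then 0 else Pi.single p 1) +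
      (if ex ℓ (p + iot ℓ 6) then 0 else Pi.single (p + iot ℓ 6) 1)) := by
  obtain ⟨h, h', hJ, hJ', h0, h0', hne⟩ := idx (j0 := j0) H hp
  have hm : -sgm F ℓ p ∈ Γ := by
    rw [sgm_eq hp]
    exact Γ.neg_mem (Γ.sub_mem (Γ.neg_mem (us_fst h)) (us_fst h'))
  rw [X_eq hm (add_mem_jIdx (us_snd h) (us_snd h'))]
  unfold hE one1 Up
  rw [wsh_single, wsh_single]
  simp only [mul_one]
  congr 1
  refine BB_ext (fun q => ?_) (fun q => ?_)
  · rw [up_fst h, up_fst h', zB_fst]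
    change _ = (-sgm F ℓ p) q
    rw [sgm_eq hp]
    by_cases h1 : ex ℓ p <;> by_cases h2 : ex ℓ (p + iot ℓ 6) <;>
      simp [h1, h2, Pi.single_apply, add_comm]
  · rw [up_snd h, up_snd h', zB_snd]
    by_cases h1 : ex ℓ p <;> by_cases h2 : ex ℓ (p + iot ℓ 6) <;>
      simp [h1, h2, Pi.single_apply, add_comm]

theorem yE_X {p : ℕ} (h : us ℓ Γ j0 p) :
    yE p = X F ℓ Γ j0 (if ex ℓ p then Pi.single p 2 else 0)
      (if ex ℓ p then 0 else Pi.single p 2) := by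
  have h1 : (if ex ℓ p then Pi.single p 2 else 0 : ℕ → F) =
      (if ex ℓ p then Pi.single p 1 else 0) + (if ex ℓ p then Pi.single p 1 else 0) := by
    split_ifs
    · rw [← Pi.single_add]; norm_num
    · simp
  have h2 : (if ex ℓ p then 0 else Pi.single p 2 : ℕ → ℕ) =
      (if ex ℓ p then 0 else Pi.single p 1) + (if ex ℓ p then 0 else Pi.single p 1) := by
    split_ifs
    · simp
    · rw [← Pi.single_add]
  rw [h1, h2, X_eq (Γ.add_mem (us_fst h) (us_fst h)) (add_mem_jIdx (us_snd h) (us_snd h))]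
  unfold yE one1 Up
  rw [wsh_single, wsh_single]
  simp only [mul_one]
  congr 1
  refine BB_ext (fun q => ?_) (fun q => ?_)
  · rw [up_fst h, up_fst h, zB_fst]
    by_cases h1 : ex ℓ p <;> simp [h1, Pi.single_apply]
  · rw [up_snd h, up_snd h, zB_snd]
    by_cases h1 : ex ℓ p <;> simp [h1, Pi.single_apply]

theorem one_X : (one1 : CA F ℓ Γ j0) = X F ℓ Γ j0 0 0 := by
  rw [X_eq Γ.zero_mem zero_mem_jIdx]; rfl

theorem hE_mem (H : Good F ℓ Γ) {p : ℕ} (hp : p ∈ Finset.Icc 1 (iot ℓ 6)) :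
    hE p ∈ A1 F ℓ Γ j0 ∪ A2 F ℓ Γ j0 := by
  have hc := iot_chain (ℓ := ℓ)
  have hp' := Finset.mem_Icc.1 hp
  rw [hE_X H hp]
  by_cases c3 : p ≤ iot ℓ 3
  · rw [if_pos ((ex_iff p).2 (by omega)), if_pos ((ex_iff _).2 (by omega)), add_zero]
    by_cases c1 : p ≤ iot ℓ 1
    · right; left; left; left
      exact ⟨p, by rw [Finset.mem_coe, mem_iSet]; norm_num; omega, rfl⟩
    · left; left; left
      exact ⟨p, by rw [Finset.mem_coe, mem_iSet]; norm_num; omega, rfl⟩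
  · rw [if_neg (c := ex ℓ (p + iot ℓ 6)) (by rw [ex_iff]; omega)]
    by_cases c5 : p ≤ iot ℓ 5
    · rw [if_pos ((ex_iff p).2 (by omega)), zero_add, ← bar_le hp'.2]
      by_cases c4 : p ≤ iot ℓ 4
      · right; left; left; right
        exact ⟨p, by rw [Finset.mem_coe, mem_iSet]; norm_num; omega, rfl⟩
      · left; left; right
        exact ⟨p, by rw [Finset.mem_coe, mem_iSet]; norm_num; omega, rfl⟩
    · have e : ¬ ex ℓ p := by rw [ex_iff]; omega
      have e' : ¬ ex ℓ (p + iot ℓ 6) := by rw [ex_iff]; omega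
      rw [sgm_eq hp, if_neg e, if_neg e', if_neg e, ← bar_le hp'.2]
      right; left; right
      exact ⟨p, by rw [Finset.mem_coe, mem_iSet]; norm_num; omega, by simp⟩

theorem one_mem : (one1 : CA F ℓ Γ j0) ∈ A1 F ℓ Γ j0 ∪ A2 F ℓ Γ j0 := by
  rw [one_X]
  cases hj : j0
  · right; right; exact ⟨rfl, rfl⟩
  · left; right; exact ⟨rfl, rfl⟩

theorem A12_cases (H : Good F ℓ Γ) {y : CA F ℓ Γ j0} (hy : y ∈ A1 F ℓ Γ j0 ∪ A2 F ℓ Γ j0) :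
    y = one1 ∨ ∃ p ∈ Finset.Icc 1 (iot ℓ 6), y = hE p := by
  have hc := iot_chain (ℓ := ℓ)
  have k3 : ∀ p, 1 ≤ p → p ≤ iot ℓ 3 →
      ∃ q ∈ Finset.Icc 1 (iot ℓ 6), X F ℓ Γ j0 (-sgm F ℓ p) 0 = hE q := by
    intro p h1 h2
    refine ⟨p, Finset.mem_Icc.2 (by omega), ?_⟩
    rw [hE_X H (Finset.mem_Icc.2 (by omega)), if_pos ((ex_iff p).2 (by omega)),
      if_pos ((ex_iff _).2 (by omega)), add_zero]
  have k5 : ∀ p, iot ℓ 3 + 1 ≤ p → p ≤ iot ℓ 5 →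
      ∃ q ∈ Finset.Icc 1 (iot ℓ 6),
        X F ℓ Γ j0 (-sgm F ℓ p) (Pi.single (bar ℓ p) 1) = hE q := by
    intro p h1 h2
    refine ⟨p, Finset.mem_Icc.2 (by omega), ?_⟩
    rw [hE_X H (Finset.mem_Icc.2 (by omega)), if_pos ((ex_iff p).2 (by omega)),
      if_neg (by rw [ex_iff]; omega), zero_add, bar_le (by omega)]
  have k6 : ∀ p, iot ℓ 5 + 1 ≤ p → p ≤ iot ℓ 6 →
      ∃ q ∈ Finset.Icc 1 (iot ℓ 6),
        X F ℓ Γ j0 0 (Pi.single p 1 + Pi.single (bar ℓ p) 1) = hE q := by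
    intro p h1 h2
    have e : ¬ ex ℓ p := by rw [ex_iff]; omega
    have e' : ¬ ex ℓ (p + iot ℓ 6) := by rw [ex_iff]; omega
    refine ⟨p, Finset.mem_Icc.2 (by omega), ?_⟩
    rw [hE_X H (Finset.mem_Icc.2 (by omega)), sgm_eq (Finset.mem_Icc.2 (by omega)),
      if_neg e, if_neg e', if_neg e, if_neg e', bar_le (by omega)]
    simp
  rcases hy with ((⟨p, hp, rfl⟩ | ⟨p, hp, rfl⟩) | ⟨-, rfl⟩) |
    (((⟨p, hp, rfl⟩ | ⟨p, hp, rfl⟩) | ⟨p, hp, rfl⟩) | ⟨-, rfl⟩)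
  · rw [Finset.mem_coe, mem_iSet] at hp
    norm_num at hp
    exact Or.inr (k3 p (by omega) (by omega))
  · rw [Finset.mem_coe, mem_iSet] at hp
    norm_num at hp
    exact Or.inr (k5 p (by omega) (by omega))
  · exact Or.inl one_X.symm
  · rw [Finset.mem_coe, mem_iSet] at hp
    norm_num at hp
    exact Or.inr (k3 p (by omega) (by omega))
  · rw [Finset.mem_coe, mem_iSet] at hp
    norm_num at hp
    exact Or.inr (k5 p (by omega) (by omega))
  · rw [Finset.mem_coe, mem_iSet] at hp
    norm_num at hp
    exact Or.inr (k6 p (by omega) (by omega))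
  · exact Or.inl one_X.symm

theorem finish (H : Good F ℓ Γ) (d : CA F ℓ Γ j0 →ₗ[F] CA F ℓ Γ j0)
    (hvan : ∀ y ∈ A1 F ℓ Γ j0 ∪ A2 F ℓ Γ j0, d y = 0) (y0 u : CA F ℓ Γ j0) (hu : inV u)
    (h1 : ∀ p ∈ Finset.Icc 1 (iot ℓ 6), brk F ℓ Γ j0 u (yE p) = d (yE p))
    (h2 : brk F ℓ Γ j0 u y0 = d y0)
    (h3 : ∀ y, (((∃ α ∈ Γ, α 0 ≠ 0) ∧ y = X F ℓ Γ j0 (Pi.single 0 (2 : F)) 0) ∨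
      ((∀ α ∈ Γ, α 0 = 0) ∧ y = X F ℓ Γ j0 0 (Pi.single 0 1))) → y = y0) :
    ∀ y ∈ A1 F ℓ Γ j0 ∪ A2 F ℓ Γ j0 ∪ A3 F ℓ Γ j0, d y - brk F ℓ Γ j0 u y = 0 := by
  have hc := iot_chain (ℓ := ℓ)
  rintro y (hy | ((⟨p, hp, rfl⟩ | ⟨p, hp, rfl⟩) | hy))
  · rw [hvan y hy, zero_sub, neg_eq_zero, brk_anti H, neg_eq_zero]
    rcases A12_cases H hy with rfl | ⟨p, hp, rfl⟩
    · rw [brk_one H, hu.2, smul_zero]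
    · rw [brk_h H hp, hu.1 p hp, sub_self]
  · rw [Finset.mem_coe, mem_iSet] at hp
    norm_num at hp
    have hI : p ∈ Finset.Icc 1 (iot ℓ 6) := Finset.mem_Icc.2 (by omega)
    have e : ex ℓ p := (ex_iff p).2 (by omega)
    have := h1 p hI
    rw [yE_X (idx H hI).1, if_pos e, if_pos e] at this
    exact sub_eq_zero.2 this.symm
  · rw [Finset.mem_coe, mem_iSet] at hp
    norm_num at hp
    have hI : p ∈ Finset.Icc 1 (iot ℓ 6) := Finset.mem_Icc.2 (by omega)
    have e : ¬ ex ℓ p := by rw [ex_iff]; omega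
    have := h1 p hI
    rw [yE_X (idx H hI).1, if_neg e, if_neg e] at this
    exact sub_eq_zero.2 this.symm
  · rw [h3 y hy, h2, sub_self]

theorem main_aux [CharZero F] (H : Good F ℓ Γ)
    (hΓ0 : (∃ α ∈ Γ, α 0 ≠ 0) → (Pi.single 0 (1 : F) : ℕ → F) ∈ Γ)
    (hJ0 : j0 = false → ∃ α ∈ Γ, α 0 ≠ 0)
    (d : CA F ℓ Γ j0 →ₗ[F] CA F ℓ Γ j0)
    (hd : ∀ u v : CA F ℓ Γ j0,
      d (brk F ℓ Γ j0 u v) = brk F ℓ Γ j0 (d u) v + brk F ℓ Γ j0 u (d v))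
    (hvan : ∀ y ∈ A1 F ℓ Γ j0 ∪ A2 F ℓ Γ j0, d y = 0) :
    ∃ u : CA F ℓ Γ j0,
      ∀ y ∈ A1 F ℓ Γ j0 ∪ A2 F ℓ Γ j0 ∪ A3 F ℓ Γ j0, d y - brk F ℓ Γ j0 u y = 0 := by
  have two_ne : (2 : F) ≠ 0 := two_ne_zero
  have e0 : ex ℓ 0 := (ex_iff 0).2 (Or.inl rfl)
  have hdh : ∀ p ∈ Finset.Icc 1 (iot ℓ 6), d (hE p) = 0 := fun p hp => hvan _ (hE_mem H hp)
  have hd1 : d one1 = 0 := hvan _ one_mem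
  by_cases hG : ∃ α ∈ Γ, α 0 ≠ 0
  · have h : us ℓ Γ j0 0 := ⟨fun _ => hΓ0 hG, fun h => absurd e0 h⟩
    have UD : ∀ w : CA F ℓ Γ j0, Up 0 (Dn 0 w) = w := fun w =>
      Up_Dn_apply h w fun b _ => by simp [wt, e0]
    have W : ee 0 (d (yE 0)) = (2 : F) • d (yE 0) := by
      have := hd one1 (yE 0)
      rw [brk_one H, brk_one H, hd1, brk_zero_left H, ee_y_self h, zero_add, map_smul,
        map_smul] at this
      exact (smul_right_injective _ two_ne this).symm
    obtain ⟨u, hu, h1, h2⟩ := core H d hd hdh hd1 (yE 0) ((2 : F) • (Up 0 * Up 0))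
      ((2⁻¹ : F) • (Dn 0 * Dn 0))
      (fun v hv => by rw [brk_y0 H h v hv]; rfl)
      (fun v => by
        simp only [LinearMap.smul_apply, Module.End.mul_apply, map_smul, Dn_Up_app h, smul_smul]
        rw [mul_inv_cancel₀ two_ne, one_smul])
      (fun v => by
        simp only [LinearMap.smul_apply, Module.End.mul_apply, map_smul, UD, smul_smul]
        rw [inv_mul_cancel₀ two_ne, one_smul])
      (fun q hq v => by
        have hq' := Finset.mem_Icc.1 hq
        simp only [LinearMap.smul_apply, Module.End.mul_apply, map_smul]
        rw [ee_Dn_ne h (by omega), ee_Dn_ne h (by omega)])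
      (fun q hq v => by
        have hq' := Finset.mem_Icc.1 hq
        have c : ∀ w : CA F ℓ Γ j0, Up q (Dn 0 w) = Dn 0 (Up q w) := fun w =>
          LinearMap.congr_fun (Up_Dn (us_of H hq) h (by omega)).eq w
        simp only [LinearMap.smul_apply, Module.End.mul_apply, map_smul, c])
      (fun q hq v => by
        have hq' := Finset.mem_Icc.1 hq
        have c : ∀ w : CA F ℓ Γ j0, Dn q (Dn 0 w) = Dn 0 (Dn q w) := fun w =>
          LinearMap.congr_fun (Dn_Dn (us_of H hq) h (by omega)).eq w
        simp only [LinearMap.smul_apply, Module.End.mul_apply, map_smul, c])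
      (fun q hq => by
        have hq' := Finset.mem_Icc.1 hq
        exact ee_y_ne h (by omega))
      (by
        simp only [LinearMap.smul_apply, Module.End.mul_apply, map_smul]
        rw [ee_Dn_self h, ee_Dn_self h, W]
        simp only [map_smul, map_sub, two_smul]
        simp)
    refine ⟨u, finish H d hvan (yE 0) u hu h1 h2 ?_⟩
    rintro y (⟨-, rfl⟩ | ⟨h', -⟩)
    · rw [yE_X h, if_pos e0, if_pos e0]
    · obtain ⟨α, hα, hα0⟩ := hG
      exact absurd (h' α hα) hα0
  · have hj : j0 = true := by
      by_contra hj
      exact hG (hJ0 (by simpa using hj))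
    have W : ee 0 (d tE) = 0 := by
      have := hd one1 tE
      rw [brk_one H, brk_one H, hd1, brk_zero_left H, ee_t hj, zero_add, map_smul, hd1,
        smul_zero] at this
      exact (smul_eq_zero.1 this.symm).resolve_left two_ne
    obtain ⟨u, hu, h1, h2⟩ := core H d hd hdh hd1 tE 1 1
      (fun v hv => brk_t H hj v hv) (fun v => rfl) (fun v => rfl) (fun q hq v => rfl)
      (fun q hq v => rfl) (fun q hq v => rfl)
      (fun q hq => by
        have hq' := Finset.mem_Icc.1 hq
        exact ee_t_ne hj (by omega)) W
    refine ⟨u, finish H d hvan tE u hu h1 h2 ?_⟩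
    rintro y (⟨h', -⟩ | ⟨-, rfl⟩)
    · exact absurd h' hG
    · rfl

end helpers
/-- **Claim 4.** If a derivation `d` of `𝒦` vanishes on `A₁ ∪ A₂`, then there
exists `u ∈ 𝒦` such that `d − ad u` vanishes on `A₁ ∪ A₂ ∪ A₃`. -/
theorem derivation_normalizable_on_A3
    {F : Type*} [Field F] [CharZero F] (ℓ : ℕ → ℕ) (Γ : AddSubgroup (ℕ → F)) (j0 : Bool)
    (hℓ : 0 < iot ℓ 6)
    (hΓ1 : ∀ p ∈ jSet ℓ 1 3 ∪ iSet ℓ 4 5, (Pi.single p (1 : F) : ℕ → F) ∈ Γ)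
    (hΓ2 : ∀ α ∈ Γ, ∀ p ∈ iSet ℓ 6 6 ∪ barSet ℓ (iSet ℓ 4 6), α p = 0)
    (hΓ3 : ∀ α ∈ Γ, ∀ p, 2 * iot ℓ 6 < p → α p = 0)
    (hΓ0 : (∃ α ∈ Γ, α 0 ≠ 0) → (Pi.single 0 (1 : F) : ℕ → F) ∈ Γ)
    (hJ0 : j0 = false → ∃ α ∈ Γ, α 0 ≠ 0)
    (d : CA F ℓ Γ j0 →ₗ[F] CA F ℓ Γ j0)
    (hd : ∀ u v : CA F ℓ Γ j0,
      d (brk F ℓ Γ j0 u v) = brk F ℓ Γ j0 (d u) v + brk F ℓ Γ j0 u (d v))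
    (hvan : ∀ y ∈ A1 F ℓ Γ j0 ∪ A2 F ℓ Γ j0, d y = 0) :
    ∃ u : CA F ℓ Γ j0,
      ∀ y ∈ A1 F ℓ Γ j0 ∪ A2 F ℓ Γ j0 ∪ A3 F ℓ Γ j0, d y - brk F ℓ Γ j0 u y = 0 := by
  exact main_aux ⟨hΓ1, hΓ2⟩ hΓ0 hJ0 d hd hvan

end
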